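/- Let ζ° lie on a wall L (one of L^±_±(m)), let C be the unique θ_{ζ°}-stable A-module with ζ°·dim C = 0, and let ζ^± be parameters in the adjacent chambers. (1) Every ζ^+-stable framed module Ṽ' fits into a short exact sequence 0 → Ṽ → Ṽ' → C^{⊕k} → 0 of Ã-modules in which Ṽ is ζ°-stable; the integer k and the isomorphism class of Ṽ are uniquely determined, and the composition ℂ^k ≅ Hom_Ã(C, C^{⊕k}) → Ext¹_Ã(C, Ṽ) induced by the extension class of Ṽ' is injective. (2) Dually, every ζ^--stable framed module Ṽ'' fits into a short exact sequence 0 → C^{⊕k} → Ṽ'' → Ṽ → 0 with Ṽ ζ°-stable, k and Ṽ uniquely determined, and the induced map ℂ^k → Ext¹_Ã(Ṽ, C) injective. -/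

import Mathlib

open Module

/-- A finite-dimensional representation of the framed conifold quiver:
vector spaces `V0`, `V1` at the two vertices of the conifold quiver `Q`
(arrows `a1 a2 : 0 → 1`, `b1 b2 : 1 → 0`, relations coming from the
superpotential `ω = a1b1a2b2 − a1b2a2b1`), and a framing space `Vf` at the
vertex `∞` with the framing arrow `w : ∞ → 0`.  An unframed `A`-module is
a `QRep` with `Vf = 0`; a framed module `Ṽ` with `dim V∞ = 1` is a `QRep`
with `dim Vf = 1`. -/
structure QRep : Type 1 where
  V0 : Type
  V1 : Type
  Vf : Type
  [acg0 : AddCommGroup V0]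
  [acg1 : AddCommGroup V1]
  [acgf : AddCommGroup Vf]
  [mod0 : Module ℂ V0]
  [mod1 : Module ℂ V1]
  [modf : Module ℂ Vf]
  [fin0 : FiniteDimensional ℂ V0]
  [fin1 : FiniteDimensional ℂ V1]
  [finf : FiniteDimensional ℂ Vf]
  a1 : V0 →ₗ[ℂ] V1
  a2 : V0 →ₗ[ℂ] V1
  b1 : V1 →ₗ[ℂ] V0
  b2 : V1 →ₗ[ℂ] V0
  w : Vf →ₗ[ℂ] V0
  rel1 : a1 ∘ₗ (b1 ∘ₗ a2) = a2 ∘ₗ (b1 ∘ₗ a1)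
  rel2 : a1 ∘ₗ (b2 ∘ₗ a2) = a2 ∘ₗ (b2 ∘ₗ a1)
  rel3 : b1 ∘ₗ (a1 ∘ₗ b2) = b2 ∘ₗ (a1 ∘ₗ b1)
  rel4 : b1 ∘ₗ (a2 ∘ₗ b2) = b2 ∘ₗ (a2 ∘ₗ b1)

attribute [instance] QRep.acg0 QRep.acg1 QRep.acgf
attribute [instance] QRep.mod0 QRep.mod1 QRep.modf
attribute [instance] QRep.fin0 QRep.fin1 QRep.finf

noncomputable def QRep.d0 (V : QRep) : ℕ := finrank ℂ V.V0
noncomputable def QRep.d1 (V : QRep) : ℕ := finrank ℂ V.V1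
noncomputable def QRep.df (V : QRep) : ℕ := finrank ℂ V.Vf

/-- A submodule of a framed module. -/
structure QSub (V : QRep) : Type where
  S0 : Submodule ℂ V.V0
  S1 : Submodule ℂ V.V1
  Sf : Submodule ℂ V.Vf
  ha1 : ∀ x ∈ S0, V.a1 x ∈ S1
  ha2 : ∀ x ∈ S0, V.a2 x ∈ S1
  hb1 : ∀ y ∈ S1, V.b1 y ∈ S0
  hb2 : ∀ y ∈ S1, V.b2 y ∈ S0
  hw : ∀ z ∈ Sf, V.w z ∈ S0

def QSub.IsBot {V : QRep} (S : QSub V) : Prop := S.S0 = ⊥ ∧ S.S1 = ⊥ ∧ S.Sf = ⊥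
def QSub.IsTop {V : QRep} (S : QSub V) : Prop := S.S0 = ⊤ ∧ S.S1 = ⊤ ∧ S.Sf = ⊤

/-- The slope `θ_ζ̃` for a weight `ζ̃ = (ζ0, ζ1, ζ∞)`. -/
noncomputable def slopeQ (z : ℝ × ℝ × ℝ) (n0 n1 nf : ℕ) : ℝ :=
  (z.1 * n0 + z.2.1 * n1 + z.2.2 * nf) / (n0 + n1 + nf)

/-- `θ_ζ̃`-stability: every nonzero proper submodule has strictly smaller
slope. -/
def IsStableQ (z : ℝ × ℝ × ℝ) (V : QRep) : Prop :=
  ∀ S : QSub V, ¬ S.IsBot → ¬ S.IsTop →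
    slopeQ z (finrank ℂ S.S0) (finrank ℂ S.S1) (finrank ℂ S.Sf) <
      slopeQ z V.d0 V.d1 V.df

/-- `ζ`-stability of a framed module (`dim Vf = 1`): `θ`-stability for the
weight `(ζ0, ζ1, −ζ0·dim V0 − ζ1·dim V1)`. -/
noncomputable def IsStableFr (ζ : ℝ × ℝ) (V : QRep) : Prop :=
  IsStableQ (ζ.1, ζ.2, -(ζ.1 * V.d0 + ζ.2 * V.d1)) V

/-- `θ_ζ`-stability of an unframed module (`Vf = 0`). -/
def IsStableUn (ζ : ℝ × ℝ) (V : QRep) : Prop :=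
  IsStableQ (ζ.1, ζ.2, 0) V

/-- A morphism of framed modules. -/
structure QHom (V W : QRep) : Type where
  g0 : V.V0 →ₗ[ℂ] W.V0
  g1 : V.V1 →ₗ[ℂ] W.V1
  gf : V.Vf →ₗ[ℂ] W.Vf
  comm_a1 : g1 ∘ₗ V.a1 = W.a1 ∘ₗ g0
  comm_a2 : g1 ∘ₗ V.a2 = W.a2 ∘ₗ g0
  comm_b1 : g0 ∘ₗ V.b1 = W.b1 ∘ₗ g1
  comm_b2 : g0 ∘ₗ V.b2 = W.b2 ∘ₗ g1
  comm_w : g0 ∘ₗ V.w = W.w ∘ₗ gf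

/-- Isomorphism of framed modules. -/
def QIso (V W : QRep) : Prop :=
  ∃ f : QHom V W, Function.Bijective f.g0 ∧ Function.Bijective f.g1 ∧
    Function.Bijective f.gf

/-- A short exact sequence `0 → B → E → T → 0` of framed modules. -/
def IsExactSeq {B E T : QRep} (i : QHom B E) (p : QHom E T) : Prop :=
  Function.Injective i.g0 ∧ Function.Injective i.g1 ∧ Function.Injective i.gf ∧
  Function.Surjective p.g0 ∧ Function.Surjective p.g1 ∧ Function.Surjective p.gf ∧
  LinearMap.range i.g0 = LinearMap.ker p.g0 ∧
  LinearMap.range i.g1 = LinearMap.ker p.g1 ∧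
  LinearMap.range i.gf = LinearMap.ker p.gf

/-- The space of Ext¹-cochains for the pair `(T, B)`: an extension
`0 → B → E → T → 0` is described, after a choice of splitting of the
underlying vector spaces, by one block `T → B` for each arrow. -/
abbrev ExtCochain (T B : QRep) : Type :=
  (T.V0 →ₗ[ℂ] B.V1) × (T.V0 →ₗ[ℂ] B.V1) × (T.V1 →ₗ[ℂ] B.V0) ×
  (T.V1 →ₗ[ℂ] B.V0) × (T.Vf →ₗ[ℂ] B.V0)

/-- The cocycle condition: the block-upper-triangular maps on `B ⊕ T`
determined by `ξ` satisfy the relations of the framed conifold algebra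
`Ã` (the linearizations of the four superpotential relations; there is no
relation involving the framing arrow). -/
def IsECocycle (T B : QRep) (ξ : ExtCochain T B) : Prop :=
  (B.b2 ∘ₗ (B.a2 ∘ₗ ξ.2.2.1) + B.b2 ∘ₗ (ξ.2.1 ∘ₗ T.b1) + ξ.2.2.2.1 ∘ₗ (T.a2 ∘ₗ T.b1) =
    B.b1 ∘ₗ (B.a2 ∘ₗ ξ.2.2.2.1) + B.b1 ∘ₗ (ξ.2.1 ∘ₗ T.b2) + ξ.2.2.1 ∘ₗ (T.a2 ∘ₗ T.b2)) ∧
  (B.b1 ∘ₗ (B.a1 ∘ₗ ξ.2.2.2.1) + B.b1 ∘ₗ (ξ.1 ∘ₗ T.b2) + ξ.2.2.1 ∘ₗ (T.a1 ∘ₗ T.b2) =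
    B.b2 ∘ₗ (B.a1 ∘ₗ ξ.2.2.1) + B.b2 ∘ₗ (ξ.1 ∘ₗ T.b1) + ξ.2.2.2.1 ∘ₗ (T.a1 ∘ₗ T.b1)) ∧
  (B.a1 ∘ₗ (B.b2 ∘ₗ ξ.2.1) + B.a1 ∘ₗ (ξ.2.2.2.1 ∘ₗ T.a2) + ξ.1 ∘ₗ (T.b2 ∘ₗ T.a2) =
    B.a2 ∘ₗ (B.b2 ∘ₗ ξ.1) + B.a2 ∘ₗ (ξ.2.2.2.1 ∘ₗ T.a1) + ξ.2.1 ∘ₗ (T.b2 ∘ₗ T.a1)) ∧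
  (B.a2 ∘ₗ (B.b1 ∘ₗ ξ.1) + B.a2 ∘ₗ (ξ.2.2.1 ∘ₗ T.a1) + ξ.2.1 ∘ₗ (T.b1 ∘ₗ T.a1) =
    B.a1 ∘ₗ (B.b1 ∘ₗ ξ.2.1) + B.a1 ∘ₗ (ξ.2.2.1 ∘ₗ T.a2) + ξ.1 ∘ₗ (T.b1 ∘ₗ T.a2))

/-- Coboundaries: the cochains describing the trivial (split) extension. -/
def IsECoboundary (T B : QRep) (ξ : ExtCochain T B) : Prop :=
  ∃ (η0 : T.V0 →ₗ[ℂ] B.V0) (η1 : T.V1 →ₗ[ℂ] B.V1) (ηf : T.Vf →ₗ[ℂ] B.Vf),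
    ξ.1 = B.a1 ∘ₗ η0 - η1 ∘ₗ T.a1 ∧
    ξ.2.1 = B.a2 ∘ₗ η0 - η1 ∘ₗ T.a2 ∧
    ξ.2.2.1 = B.b1 ∘ₗ η1 - η0 ∘ₗ T.b1 ∧
    ξ.2.2.2.1 = B.b2 ∘ₗ η1 - η0 ∘ₗ T.b2 ∧
    ξ.2.2.2.2 = B.w ∘ₗ ηf - η0 ∘ₗ T.w

/-- `n = dim_ℂ Ext¹_Ã(T, B)` (extensions `0 → B → E → T → 0` in the
category of `Ã`-modules), characterized by the existence of a family of
cocycles whose classes form a basis of cocycles modulo coboundaries. -/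
def IsExt1Dim (T B : QRep) (n : ℕ) : Prop :=
  ∃ ξ : Fin n → ExtCochain T B,
    (∀ i, IsECocycle T B (ξ i)) ∧
    (∀ c : Fin n → ℂ, IsECoboundary T B (∑ i, c i • ξ i) → c = 0) ∧
    (∀ ζ : ExtCochain T B, IsECocycle T B ζ →
      ∃ c : Fin n → ℂ, IsECoboundary T B (ζ - ∑ i, c i • ξ i))



/-- `ζ` lies on one of the walls `L^∓_+(m)` (`m ≥ 1`) or `L^∓_-(m)`
(`m ≥ 0`). -/
def OnWall (ζ : ℝ × ℝ) (m : ℕ) : Prop :=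
  (1 ≤ m ∧ ζ.1 < ζ.2 ∧ (m : ℝ) * ζ.1 + ((m : ℝ) - 1) * ζ.2 = 0) ∨
  (ζ.1 < ζ.2 ∧ (m : ℝ) * ζ.1 + ((m : ℝ) + 1) * ζ.2 = 0) ∨
  (1 ≤ m ∧ ζ.2 < ζ.1 ∧ (m : ℝ) * ζ.1 + ((m : ℝ) - 1) * ζ.2 = 0) ∨
  (ζ.2 < ζ.1 ∧ (m : ℝ) * ζ.1 + ((m : ℝ) + 1) * ζ.2 = 0)

/-- Componentwise application of a linear map to `k`-tuples. -/
def pmap {A B : Type} [AddCommGroup A] [AddCommGroup B] [Module ℂ A]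
    [Module ℂ B] (k : ℕ) (f : A →ₗ[ℂ] B) : (Fin k → A) →ₗ[ℂ] (Fin k → B) :=
  LinearMap.pi (fun i => f ∘ₗ LinearMap.proj i)

/-- The direct sum `C^{⊕k}` of `k` copies of a framed module. -/
def QRep.pow (C : QRep) (k : ℕ) : QRep where
  V0 := Fin k → C.V0
  V1 := Fin k → C.V1
  Vf := Fin k → C.Vf
  a1 := pmap k C.a1
  a2 := pmap k C.a2
  b1 := pmap k C.b1
  b2 := pmap k C.b2
  w := pmap k C.w
  rel1 := LinearMap.ext fun x => funext fun i =>
    LinearMap.congr_fun C.rel1 (x i)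
  rel2 := LinearMap.ext fun x => funext fun i =>
    LinearMap.congr_fun C.rel2 (x i)
  rel3 := LinearMap.ext fun x => funext fun i =>
    LinearMap.congr_fun C.rel3 (x i)
  rel4 := LinearMap.ext fun x => funext fun i =>
    LinearMap.congr_fun C.rel4 (x i)

/-- Assembling `k` cochains for the pair `(C, B)` into a cochain for
`(C^{⊕k}, B)`: describes extensions `0 → B → E → C^{⊕k} → 0`. -/
noncomputable def assembleRow {C B : QRep} {k : ℕ}
    (ξ : Fin k → ExtCochain C B) : ExtCochain (C.pow k) B :=
  (∑ j, (ξ j).1 ∘ₗ LinearMap.proj j,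
   ∑ j, (ξ j).2.1 ∘ₗ LinearMap.proj j,
   ∑ j, (ξ j).2.2.1 ∘ₗ LinearMap.proj j,
   ∑ j, (ξ j).2.2.2.1 ∘ₗ LinearMap.proj j,
   ∑ j, (ξ j).2.2.2.2 ∘ₗ LinearMap.proj j)

/-- Assembling `k` cochains for the pair `(T, C)` into a cochain for
`(T, C^{⊕k})`: describes extensions `0 → C^{⊕k} → E → T → 0`. -/
noncomputable def assembleCol {T C : QRep} {k : ℕ}
    (ξ : Fin k → ExtCochain T C) : ExtCochain T (C.pow k) :=
  (LinearMap.pi (fun j => (ξ j).1),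
   LinearMap.pi (fun j => (ξ j).2.1),
   LinearMap.pi (fun j => (ξ j).2.2.1),
   LinearMap.pi (fun j => (ξ j).2.2.2.1),
   LinearMap.pi (fun j => (ξ j).2.2.2.2))

/-- The exact sequence `0 → B → E → T → 0` given by `(i, p)` realizes the
extension class of the cochain `ξ`: there are vector space splittings of
`p` with respect to which the arrows of `E` are block upper triangular
with off-diagonal blocks `ξ`. -/
def RealizesExt {B E T : QRep} (i : QHom B E) (p : QHom E T)
    (ξ : ExtCochain T B) : Prop :=
  IsExactSeq i p ∧
  ∃ (s0 : T.V0 →ₗ[ℂ] E.V0) (s1 : T.V1 →ₗ[ℂ] E.V1) (sf : T.Vf →ₗ[ℂ] E.Vf),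
    p.g0 ∘ₗ s0 = LinearMap.id ∧ p.g1 ∘ₗ s1 = LinearMap.id ∧
    p.gf ∘ₗ sf = LinearMap.id ∧
    i.g1 ∘ₗ ξ.1 = E.a1 ∘ₗ s0 - s1 ∘ₗ T.a1 ∧
    i.g1 ∘ₗ ξ.2.1 = E.a2 ∘ₗ s0 - s1 ∘ₗ T.a2 ∧
    i.g0 ∘ₗ ξ.2.2.1 = E.b1 ∘ₗ s1 - s0 ∘ₗ T.b1 ∧
    i.g0 ∘ₗ ξ.2.2.2.1 = E.b2 ∘ₗ s1 - s0 ∘ₗ T.b2 ∧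
    i.g0 ∘ₗ ξ.2.2.2.2 = E.w ∘ₗ sf - s0 ∘ₗ T.w

/-! ### Linear algebra -/

section LinearAlgebra

variable {U V W : Type*} [AddCommGroup U] [Module ℂ U] [AddCommGroup V] [Module ℂ V]
  [AddCommGroup W] [Module ℂ W]

theorem exists_lift_of_range_le {i : U →ₗ[ℂ] W} {j : V →ₗ[ℂ] W} (hj : Function.Injective j)
    (h : LinearMap.range i ≤ LinearMap.range j) : ∃ g : U →ₗ[ℂ] V, j ∘ₗ g = i := by
  obtain ⟨r, hr⟩ := LinearMap.exists_leftInverse_of_injective j (LinearMap.ker_eq_bot.2 hj)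
  refine ⟨r ∘ₗ i, LinearMap.ext fun x => ?_⟩
  obtain ⟨y, hy⟩ := h ⟨x, rfl⟩
  have := LinearMap.congr_fun hr y
  simp only [LinearMap.comp_apply, LinearMap.id_apply] at this ⊢
  rw [← hy, this]

theorem exists_desc_of_ker_le {p : U →ₗ[ℂ] V} {q : U →ₗ[ℂ] W} (hp : Function.Surjective p)
    (h : LinearMap.ker p ≤ LinearMap.ker q) : ∃ g : V →ₗ[ℂ] W, g ∘ₗ p = q := by
  obtain ⟨s, hs⟩ := LinearMap.exists_rightInverse_of_surjective p (LinearMap.range_eq_top.2 hp)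
  refine ⟨q ∘ₗ s, LinearMap.ext fun x => ?_⟩
  have h1 : s (p x) - x ∈ LinearMap.ker p := by
    have := LinearMap.congr_fun hs (p x)
    simp only [LinearMap.comp_apply, LinearMap.id_apply] at this
    simp [this]
  have h2 := h h1
  simp only [LinearMap.mem_ker, map_sub, sub_eq_zero] at h2
  simpa using h2

theorem finrank_comap_of_surjective [FiniteDimensional ℂ U] [FiniteDimensional ℂ V]
    {f : U →ₗ[ℂ] V} (hf : Function.Surjective f) (T : Submodule ℂ V) :
    finrank ℂ (T.comap f) = finrank ℂ T + finrank ℂ (LinearMap.ker f) := by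
  have h1 := LinearMap.finrank_range_add_finrank_ker f
  have h2 := LinearMap.finrank_range_add_finrank_ker (T.mkQ ∘ₗ f)
  rw [LinearMap.range_eq_top.2 hf, finrank_top] at h1
  rw [LinearMap.range_comp, LinearMap.range_eq_top.2 hf, Submodule.map_top, Submodule.range_mkQ,
    finrank_top, LinearMap.ker_comp,
    Submodule.ker_mkQ] at h2
  have h3 := T.finrank_quotient_add_finrank
  omega

theorem finrank_map_of_injective {f : U →ₗ[ℂ] V} (hf : Function.Injective f)
    (T : Submodule ℂ U) : finrank ℂ (T.map f) = finrank ℂ T :=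
  (Submodule.equivMapOfInjective f hf T).finrank_eq.symm

theorem finrank_sup_range_add_finrank_comap [FiniteDimensional ℂ U] [FiniteDimensional ℂ V]
    (f : U →ₗ[ℂ] V) (S : Submodule ℂ V) :
    finrank ℂ ↥(S ⊔ LinearMap.range f) + finrank ℂ (S.comap f) =
      finrank ℂ S + finrank ℂ U := by
  have h1 := LinearMap.finrank_range_add_finrank_ker (S.mkQ ∘ₗ f)
  have hr : LinearMap.range (S.mkQ ∘ₗ f) = (S ⊔ LinearMap.range f).map S.mkQ := by
    rw [LinearMap.range_comp, Submodule.map_sup, Submodule.mkQ_map_self, bot_sup_eq]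
  have h3 := finrank_comap_of_surjective S.mkQ_surjective ((S ⊔ LinearMap.range f).map S.mkQ)
  rw [Submodule.comap_map_mkQ, Submodule.ker_mkQ, ← sup_assoc, sup_idem] at h3
  rw [hr, LinearMap.ker_comp, Submodule.ker_mkQ] at h1
  omega

theorem finrank_sup_map_add_finrank_inf_comap [FiniteDimensional ℂ U] (f : U →ₗ[ℂ] U)
    (S : Submodule ℂ U) :
    finrank ℂ ↥(S ⊔ S.map f) + finrank ℂ ↥(S ⊓ S.comap f) = 2 * finrank ℂ S := by
  have h1 := finrank_sup_range_add_finrank_comap (f ∘ₗ S.subtype) S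
  have h2 : finrank ℂ (S.comap (f ∘ₗ S.subtype)) = finrank ℂ ↥(S ⊓ S.comap f) := by
    rw [← finrank_map_of_injective S.subtype_injective, Submodule.comap_comp,
      Submodule.map_comap_subtype]
  rw [LinearMap.range_comp, Submodule.range_subtype, h2] at h1
  omega

theorem exists_lex_max {X : Type*} (P : X → Prop) (hP : ∃ x, P x) (d₀ d₁ : X → ℕ) (N₀ N₁ : ℕ)
    (h₀ : ∀ x, d₀ x ≤ N₀) (h₁ : ∀ x, d₁ x ≤ N₁) (f g : ℕ → ℕ → ℝ) :
    ∃ x, P x ∧ ∀ y, P y → f (d₀ y) (d₁ y) ≤ f (d₀ x) (d₁ x) ∧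
      (f (d₀ y) (d₁ y) = f (d₀ x) (d₁ x) → g (d₀ y) (d₁ y) ≤ g (d₀ x) (d₁ x)) := by
  let s : Set (ℕ × ℕ) := {n | ∃ x, P x ∧ (d₀ x, d₁ x) = n}
  have hs : s.Finite := by
    refine ((Set.finite_Iic N₀).prod (Set.finite_Iic N₁)).subset ?_
    rintro _ ⟨x, -, rfl⟩
    exact ⟨h₀ x, h₁ x⟩
  obtain ⟨x₀, hx₀⟩ := hP
  obtain ⟨a, ⟨x, hx, rfl⟩, ha⟩ :=
    s.exists_max_image (fun n => toLex (f n.1 n.2, g n.1 n.2)) hs ⟨_, x₀, hx₀, rfl⟩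
  refine ⟨x, hx, fun y hy => ?_⟩
  have := ha _ ⟨y, hy, rfl⟩
  rw [Prod.Lex.toLex_le_toLex] at this
  rcases this with h | ⟨h, h'⟩
  · exact ⟨h.le, fun e => absurd e h.ne⟩
  · exact ⟨h.le, fun _ => h'⟩

end LinearAlgebra

/-! ### Submodules, images and quotients of representations -/

namespace QSub

variable {V W : QRep}

noncomputable def wt (ζ : ℝ × ℝ) (S : QSub V) : ℝ :=
  ζ.1 * (finrank ℂ S.S0 : ℝ) + ζ.2 * (finrank ℂ S.S1 : ℝ)

noncomputable def dim (S : QSub V) : ℕ := finrank ℂ S.S0 + finrank ℂ S.S1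

@[simps]
def sup (S T : QSub V) : QSub V where
  S0 := S.S0 ⊔ T.S0
  S1 := S.S1 ⊔ T.S1
  Sf := S.Sf ⊔ T.Sf
  ha1 x hx := by
    obtain ⟨y, hy, z, hz, rfl⟩ := Submodule.mem_sup.1 hx
    rw [map_add]
    exact Submodule.add_mem_sup (S.ha1 y hy) (T.ha1 z hz)
  ha2 x hx := by
    obtain ⟨y, hy, z, hz, rfl⟩ := Submodule.mem_sup.1 hx
    rw [map_add]
    exact Submodule.add_mem_sup (S.ha2 y hy) (T.ha2 z hz)
  hb1 x hx := by
    obtain ⟨y, hy, z, hz, rfl⟩ := Submodule.mem_sup.1 hx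
    rw [map_add]
    exact Submodule.add_mem_sup (S.hb1 y hy) (T.hb1 z hz)
  hb2 x hx := by
    obtain ⟨y, hy, z, hz, rfl⟩ := Submodule.mem_sup.1 hx
    rw [map_add]
    exact Submodule.add_mem_sup (S.hb2 y hy) (T.hb2 z hz)
  hw x hx := by
    obtain ⟨y, hy, z, hz, rfl⟩ := Submodule.mem_sup.1 hx
    rw [map_add]
    exact Submodule.add_mem_sup (S.hw y hy) (T.hw z hz)

/-- The largest submodule. -/
def top (V : QRep) : QSub V := ⟨⊤, ⊤, ⊤, by simp, by simp, by simp, by simp, by simp⟩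

/-- The zero submodule. -/
def bot (V : QRep) : QSub V := ⟨⊥, ⊥, ⊥, by simp, by simp, by simp, by simp, by simp⟩

/-- A submodule as a representation. -/
def toRep (S : QSub V) : QRep where
  V0 := S.S0
  V1 := S.S1
  Vf := S.Sf
  a1 := V.a1.restrict S.ha1
  a2 := V.a2.restrict S.ha2
  b1 := V.b1.restrict S.hb1
  b2 := V.b2.restrict S.hb2
  w := V.w.restrict S.hw
  rel1 := LinearMap.ext fun x => Subtype.ext (LinearMap.congr_fun V.rel1 x)
  rel2 := LinearMap.ext fun x => Subtype.ext (LinearMap.congr_fun V.rel2 x)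
  rel3 := LinearMap.ext fun x => Subtype.ext (LinearMap.congr_fun V.rel3 x)
  rel4 := LinearMap.ext fun x => Subtype.ext (LinearMap.congr_fun V.rel4 x)

/-- The quotient of a representation by a submodule. -/
def quot (S : QSub V) : QRep where
  V0 := V.V0 ⧸ S.S0
  V1 := V.V1 ⧸ S.S1
  Vf := V.Vf ⧸ S.Sf
  a1 := Submodule.mapQ _ _ V.a1 S.ha1
  a2 := Submodule.mapQ _ _ V.a2 S.ha2
  b1 := Submodule.mapQ _ _ V.b1 S.hb1
  b2 := Submodule.mapQ _ _ V.b2 S.hb2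
  w := Submodule.mapQ _ _ V.w S.hw
  rel1 := Submodule.linearMap_qext _ <| LinearMap.ext fun x =>
    congrArg (Submodule.Quotient.mk (p := S.S1)) (LinearMap.congr_fun V.rel1 x)
  rel2 := Submodule.linearMap_qext _ <| LinearMap.ext fun x =>
    congrArg (Submodule.Quotient.mk (p := S.S1)) (LinearMap.congr_fun V.rel2 x)
  rel3 := Submodule.linearMap_qext _ <| LinearMap.ext fun x =>
    congrArg (Submodule.Quotient.mk (p := S.S0)) (LinearMap.congr_fun V.rel3 x)
  rel4 := Submodule.linearMap_qext _ <| LinearMap.ext fun x =>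
    congrArg (Submodule.Quotient.mk (p := S.S0)) (LinearMap.congr_fun V.rel4 x)

/-- The inclusion of a submodule. -/
def incl (S : QSub V) : QHom S.toRep V where
  g0 := S.S0.subtype
  g1 := S.S1.subtype
  gf := S.Sf.subtype
  comm_a1 := rfl
  comm_a2 := rfl
  comm_b1 := rfl
  comm_b2 := rfl
  comm_w := rfl

/-- The projection to a quotient. -/
def proj (S : QSub V) : QHom V S.quot where
  g0 := S.S0.mkQ
  g1 := S.S1.mkQ
  gf := S.Sf.mkQ
  comm_a1 := rfl
  comm_a2 := rfl
  comm_b1 := rfl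
  comm_b2 := rfl
  comm_w := rfl

/-- The image of a submodule under a morphism. -/
@[simps]
def map (f : QHom V W) (S : QSub V) : QSub W where
  S0 := S.S0.map f.g0
  S1 := S.S1.map f.g1
  Sf := S.Sf.map f.gf
  ha1 := by
    rintro _ ⟨x, hx, rfl⟩
    exact ⟨_, S.ha1 x hx, LinearMap.congr_fun f.comm_a1 x⟩
  ha2 := by
    rintro _ ⟨x, hx, rfl⟩
    exact ⟨_, S.ha2 x hx, LinearMap.congr_fun f.comm_a2 x⟩
  hb1 := by
    rintro _ ⟨x, hx, rfl⟩
    exact ⟨_, S.hb1 x hx, LinearMap.congr_fun f.comm_b1 x⟩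
  hb2 := by
    rintro _ ⟨x, hx, rfl⟩
    exact ⟨_, S.hb2 x hx, LinearMap.congr_fun f.comm_b2 x⟩
  hw := by
    rintro _ ⟨x, hx, rfl⟩
    exact ⟨_, S.hw x hx, LinearMap.congr_fun f.comm_w x⟩

/-- The preimage of a submodule under a morphism. -/
@[simps]
def comap (f : QHom V W) (S : QSub W) : QSub V where
  S0 := S.S0.comap f.g0
  S1 := S.S1.comap f.g1
  Sf := S.Sf.comap f.gf
  ha1 x hx := by
    have := LinearMap.congr_fun f.comm_a1 x
    simp only [LinearMap.comp_apply] at this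
    simpa [this] using S.ha1 _ hx
  ha2 x hx := by
    have := LinearMap.congr_fun f.comm_a2 x
    simp only [LinearMap.comp_apply] at this
    simpa [this] using S.ha2 _ hx
  hb1 x hx := by
    have := LinearMap.congr_fun f.comm_b1 x
    simp only [LinearMap.comp_apply] at this
    simpa [this] using S.hb1 _ hx
  hb2 x hx := by
    have := LinearMap.congr_fun f.comm_b2 x
    simp only [LinearMap.comp_apply] at this
    simpa [this] using S.hb2 _ hx
  hw x hx := by
    have := LinearMap.congr_fun f.comm_w x
    simp only [LinearMap.comp_apply] at this
    simpa [this] using S.hw _ hx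

/-- The submodule of an unframed nature spanned by a stable pair of subspaces. -/
def ofPair (S0 : Submodule ℂ V.V0) (S1 : Submodule ℂ V.V1)
    (h1 : ∀ x ∈ S0, V.a1 x ∈ S1) (h2 : ∀ x ∈ S0, V.a2 x ∈ S1)
    (h3 : ∀ x ∈ S1, V.b1 x ∈ S0) (h4 : ∀ x ∈ S1, V.b2 x ∈ S0) : QSub V :=
  ⟨S0, S1, ⊥, h1, h2, h3, h4, by simp⟩

theorem wt_add_smul (ζ : ℝ × ℝ) (ε : ℝ) (S : QSub V) :
    S.wt (ζ.1 + ε, ζ.2 + ε) = S.wt ζ + ε * S.dim := by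
  simp [wt, dim]; ring

theorem dim_pos {S : QSub V} (hf : S.Sf = ⊥) (h : ¬ S.IsBot) : 0 < S.dim := by
  rw [Nat.pos_iff_ne_zero]
  intro h0
  rw [dim, Nat.add_eq_zero_iff, Submodule.finrank_eq_zero, Submodule.finrank_eq_zero] at h0
  exact h ⟨h0.1, h0.2, hf⟩

theorem finrank_S0_le (S : QSub V) : finrank ℂ S.S0 ≤ V.d0 := Submodule.finrank_le _

theorem finrank_S1_le (S : QSub V) : finrank ℂ S.S1 ≤ V.d1 := Submodule.finrank_le _

theorem dim_lt {S : QSub V} (hf : S.Sf = ⊤) (h : ¬ S.IsTop) : S.dim < V.d0 + V.d1 := by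
  by_contra! h0
  have h1 := S.finrank_S0_le
  have h2 := S.finrank_S1_le
  rw [dim] at h0
  refine h ⟨Submodule.eq_top_of_finrank_eq ?_, Submodule.eq_top_of_finrank_eq ?_, hf⟩
  · change _ = V.d0
    omega
  · change _ = V.d1
    omega

end QSub

noncomputable def QRep.wt (ζ : ℝ × ℝ) (V : QRep) : ℝ := ζ.1 * (V.d0 : ℝ) + ζ.2 * (V.d1 : ℝ)

theorem QRep.wt_add_smul (ζ : ℝ × ℝ) (ε : ℝ) (V : QRep) :
    V.wt (ζ.1 + ε, ζ.2 + ε) = V.wt ζ + ε * ((V.d0 + V.d1 : ℕ) : ℝ) := by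
  simp [QRep.wt]; ring

namespace QSub

variable {V W : QRep}

theorem wt_top (ζ : ℝ × ℝ) : (top V).wt ζ = V.wt ζ := by
  dsimp only [wt, QRep.wt, QRep.d0, QRep.d1, top]
  rw [finrank_top, finrank_top]

theorem wt_bot (ζ : ℝ × ℝ) : (bot V).wt ζ = 0 := by
  dsimp only [wt, bot]
  simp

theorem d0_quot (S : QSub V) : S.quot.d0 + finrank ℂ S.S0 = V.d0 :=
  S.S0.finrank_quotient_add_finrank

theorem d1_quot (S : QSub V) : S.quot.d1 + finrank ℂ S.S1 = V.d1 :=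
  S.S1.finrank_quotient_add_finrank

theorem wt_quot (ζ : ℝ × ℝ) (S : QSub V) : S.quot.wt ζ = V.wt ζ - S.wt ζ := by
  have h0 := S.d0_quot
  have h1 := S.d1_quot
  rify at h0 h1
  simp only [wt, QRep.wt]
  linear_combination ζ.1 * h0 + ζ.2 * h1

theorem finrank_map_incl_S0 (S : QSub V) (T : QSub S.toRep) :
    finrank ℂ (T.map S.incl).S0 = finrank ℂ T.S0 :=
  finrank_map_of_injective S.S0.subtype_injective T.S0

theorem finrank_map_incl_S1 (S : QSub V) (T : QSub S.toRep) :
    finrank ℂ (T.map S.incl).S1 = finrank ℂ T.S1 :=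
  finrank_map_of_injective S.S1.subtype_injective T.S1

theorem wt_map_incl (ζ : ℝ × ℝ) (S : QSub V) (T : QSub S.toRep) :
    (T.map S.incl).wt ζ = T.wt ζ := by
  rw [wt, finrank_map_incl_S0, finrank_map_incl_S1, wt]

theorem dim_map_incl (S : QSub V) (T : QSub S.toRep) : (T.map S.incl).dim = T.dim := by
  rw [dim, finrank_map_incl_S0, finrank_map_incl_S1, dim]

theorem finrank_comap_proj_S0 (S : QSub V) (T : QSub S.quot) :
    finrank ℂ (T.comap S.proj).S0 = finrank ℂ T.S0 + finrank ℂ S.S0 := by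
  have := finrank_comap_of_surjective S.S0.mkQ_surjective T.S0
  rwa [Submodule.ker_mkQ] at this

theorem finrank_comap_proj_S1 (S : QSub V) (T : QSub S.quot) :
    finrank ℂ (T.comap S.proj).S1 = finrank ℂ T.S1 + finrank ℂ S.S1 := by
  have := finrank_comap_of_surjective S.S1.mkQ_surjective T.S1
  rwa [Submodule.ker_mkQ] at this

theorem wt_comap_proj (ζ : ℝ × ℝ) (S : QSub V) (T : QSub S.quot) :
    (T.comap S.proj).wt ζ = T.wt ζ + S.wt ζ := by
  simp only [wt, finrank_comap_proj_S0, finrank_comap_proj_S1]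
  push_cast; ring

theorem dim_comap_proj (S : QSub V) (T : QSub S.quot) :
    (T.comap S.proj).dim = T.dim + S.dim := by
  simp only [dim, finrank_comap_proj_S0, finrank_comap_proj_S1]
  ring

end QSub

/-! ### Unframed representations -/

/-- A stable unframed representation of weight zero. -/
structure IsStableZero (ζ : ℝ × ℝ) (V : QRep) : Prop where
  unframed : finrank ℂ V.Vf = 0
  dim_pos : 0 < V.d0 + V.d1
  wt_eq : V.wt ζ = 0
  wt_neg : ∀ S : QSub V, ¬ S.IsBot → ¬ S.IsTop → S.wt ζ < 0

/-- A semistable unframed representation of weight zero. -/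
structure IsSemistableZero (ζ : ℝ × ℝ) (V : QRep) : Prop where
  unframed : finrank ℂ V.Vf = 0
  wt_eq : V.wt ζ = 0
  wt_le : ∀ S : QSub V, S.wt ζ ≤ 0

theorem isStableUn_iff {ζ : ℝ × ℝ} {V : QRep} (hf : finrank ℂ V.Vf = 0) :
    IsStableUn ζ V ↔ ∀ S : QSub V, ¬ S.IsBot → ¬ S.IsTop →
      S.wt ζ / S.dim < V.wt ζ / (V.d0 + V.d1 : ℕ) := by
  have : Subsingleton V.Vf := finrank_zero_iff.1 hf
  have hS (S : QSub V) : finrank ℂ S.Sf = 0 := by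
    rw [Submodule.finrank_eq_zero]; exact Subsingleton.elim _ _
  simp [IsStableUn, IsStableQ, slopeQ, hS, QSub.wt, QSub.dim, QRep.wt, QRep.df, hf]

theorem IsStableUn.isStableZero {ζ : ℝ × ℝ} {V : QRep} (hf : finrank ℂ V.Vf = 0)
    (hd : 0 < V.d0 + V.d1) (h : IsStableUn ζ V) :
    IsStableZero (ζ.1 + -(V.wt ζ / (V.d0 + V.d1 : ℕ)), ζ.2 + -(V.wt ζ / (V.d0 + V.d1 : ℕ))) V where
  unframed := hf
  dim_pos := hd
  wt_eq := by
    rw [QRep.wt_add_smul]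
    have : ((V.d0 + V.d1 : ℕ) : ℝ) ≠ 0 := by exact_mod_cast hd.ne'
    field_simp
    ring
  wt_neg S hb ht := by
    have : Subsingleton V.Vf := finrank_zero_iff.1 hf
    have h1 := (isStableUn_iff hf).1 h S hb ht
    have h2 : (0 : ℝ) < S.dim := by exact_mod_cast QSub.dim_pos (Subsingleton.elim _ _) hb
    rw [div_lt_iff₀ h2] at h1
    rw [QSub.wt_add_smul]
    linarith

namespace QRep

/-- The representation with the roles of the two vertices exchanged. -/
def swap (V : QRep) : QRep where
  V0 := V.V1
  V1 := V.V0
  Vf := PUnit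
  a1 := V.b1
  a2 := V.b2
  b1 := V.a1
  b2 := V.a2
  w := 0
  rel1 := V.rel3
  rel2 := V.rel4
  rel3 := V.rel1
  rel4 := V.rel2

/-- The arrows from vertex `0` to vertex `1`. -/
def a (V : QRep) (i : Fin 2) : V.V0 →ₗ[ℂ] V.V1 := ![V.a1, V.a2] i

/-- The arrows from vertex `1` to vertex `0`. -/
def b (V : QRep) (i : Fin 2) : V.V1 →ₗ[ℂ] V.V0 := ![V.b1, V.b2] i

@[simp] theorem a_zero (V : QRep) : V.a 0 = V.a1 := rfl
@[simp] theorem a_one (V : QRep) : V.a 1 = V.a2 := rfl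
@[simp] theorem b_zero (V : QRep) : V.b 0 = V.b1 := rfl
@[simp] theorem b_one (V : QRep) : V.b 1 = V.b2 := rfl

theorem a_b_a (V : QRep) (i j k : Fin 2) (x : V.V0) :
    V.a i (V.b j (V.a k x)) = V.a k (V.b j (V.a i x)) := by
  have h1 := LinearMap.congr_fun V.rel1 x
  have h2 := LinearMap.congr_fun V.rel2 x
  simp only [LinearMap.comp_apply] at h1 h2
  fin_cases i <;> fin_cases j <;> fin_cases k <;> simp [h1, h2]

theorem b_a_b (V : QRep) (i j k : Fin 2) (x : V.V1) :
    V.b i (V.a j (V.b k x)) = V.b k (V.a j (V.b i x)) := by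
  have h1 := LinearMap.congr_fun V.rel3 x
  have h2 := LinearMap.congr_fun V.rel4 x
  simp only [LinearMap.comp_apply] at h1 h2
  fin_cases i <;> fin_cases j <;> fin_cases k <;> simp [h1, h2]

/-- A morphism of the representations of the Kronecker quiver given by the arrows `b1`, `b2`. -/
def IsKronHom (V W : QRep) (f0 : V.V0 →ₗ[ℂ] W.V0) (f1 : V.V1 →ₗ[ℂ] W.V1) : Prop :=
  ∀ j, f0 ∘ₗ V.b j = W.b j ∘ₗ f1

theorem IsKronHom.apply {V W : QRep} {f0 : V.V0 →ₗ[ℂ] W.V0} {f1 : V.V1 →ₗ[ℂ] W.V1}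
    (h : IsKronHom V W f0 f1) (j : Fin 2) (x : V.V1) : f0 (V.b j x) = W.b j (f1 x) :=
  LinearMap.congr_fun (h j) x

theorem isKronHom_loop (V : QRep) (i j : Fin 2) :
    IsKronHom V V (V.b j ∘ₗ V.a i) (V.a i ∘ₗ V.b j) := fun k =>
  LinearMap.ext fun x => V.b_a_b j i k x

/-- The central element of the conifold algebra given by a pair of arrows, acting on an unframed
representation. -/
def loop (V : QRep) (hf : finrank ℂ V.Vf = 0) (i j : Fin 2) : QHom V V where
  g0 := V.b j ∘ₗ V.a i
  g1 := V.a i ∘ₗ V.b j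
  gf := 0
  comm_a1 := LinearMap.ext fun x => V.a_b_a i j 0 x
  comm_a2 := LinearMap.ext fun x => V.a_b_a i j 1 x
  comm_b1 := LinearMap.ext fun x => V.b_a_b j i 0 x
  comm_b2 := LinearMap.ext fun x => V.b_a_b j i 1 x
  comm_w := by
    have : Subsingleton V.Vf := finrank_zero_iff.1 hf
    exact LinearMap.ext fun x => by simp [Subsingleton.elim x 0]

/-- A morphism of Kronecker representations between unframed representations on which the
remaining arrows vanish. -/
def homOfKron {V W : QRep} (hV : ∀ i, V.a i = 0) (hW : ∀ i, W.a i = 0)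
    (hf : finrank ℂ V.Vf = 0) {f0 : V.V0 →ₗ[ℂ] W.V0} {f1 : V.V1 →ₗ[ℂ] W.V1}
    (h : IsKronHom V W f0 f1) : QHom V W where
  g0 := f0
  g1 := f1
  gf := 0
  comm_a1 := by rw [← V.a_zero, ← W.a_zero, hV, hW]; simp
  comm_a2 := by rw [← V.a_one, ← W.a_one, hV, hW]; simp
  comm_b1 := h 0
  comm_b2 := h 1
  comm_w := by
    have : Subsingleton V.Vf := finrank_zero_iff.1 hf
    exact LinearMap.ext fun x => by simp [Subsingleton.elim x 0]

/-- The linear map whose kernel is the space of Kronecker morphisms. -/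
def kronDiff (V W : QRep) : (V.V0 →ₗ[ℂ] W.V0) × (V.V1 →ₗ[ℂ] W.V1) →ₗ[ℂ]
    (V.V1 →ₗ[ℂ] W.V0) × (V.V1 →ₗ[ℂ] W.V0) where
  toFun f := (f.1 ∘ₗ V.b 0 - W.b 0 ∘ₗ f.2, f.1 ∘ₗ V.b 1 - W.b 1 ∘ₗ f.2)
  map_add' f g := by
    simp only [Prod.fst_add, Prod.snd_add, LinearMap.add_comp, LinearMap.comp_add,
      Prod.mk_add_mk, add_sub_add_comm]
  map_smul' c f := by
    simp only [Prod.smul_fst, Prod.smul_snd, LinearMap.smul_comp, LinearMap.comp_smul,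
      Prod.smul_mk, smul_sub, RingHom.id_apply]

theorem mem_ker_kronDiff {V W : QRep} {f : (V.V0 →ₗ[ℂ] W.V0) × (V.V1 →ₗ[ℂ] W.V1)} :
    f ∈ LinearMap.ker (kronDiff V W) ↔ IsKronHom V W f.1 f.2 := by
  simp [kronDiff, IsKronHom, Fin.forall_fin_two, sub_eq_zero]

theorem le_finrank_ker_kronDiff (V W : QRep) :
    V.d0 * W.d0 + V.d1 * W.d1 ≤
      finrank ℂ (LinearMap.ker (kronDiff V W)) + 2 * (V.d1 * W.d0) := by
  have h1 := LinearMap.finrank_range_add_finrank_ker (kronDiff V W)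
  have h2 := Submodule.finrank_le (LinearMap.range (kronDiff V W))
  simp only [finrank_prod, finrank_linearMap] at h1 h2
  simp only [d0, d1]
  omega

end QRep

/-! ### Stable unframed representations -/

namespace QSub

variable {V W : QRep}

theorem IsBot.wt_eq {S : QSub V} (h : S.IsBot) (ζ : ℝ × ℝ) : S.wt ζ = 0 := by
  rw [wt, h.1, h.2.1, finrank_bot, finrank_bot]
  simp

theorem IsTop.wt_eq {S : QSub V} (h : S.IsTop) (ζ : ℝ × ℝ) : S.wt ζ = V.wt ζ := by
  rw [wt, h.1, h.2.1, finrank_top, finrank_top]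
  rfl

theorem wt_ker_add_wt_range (ζ : ℝ × ℝ) (f : QHom V W) :
    ((bot W).comap f).wt ζ + ((top V).map f).wt ζ = V.wt ζ := by
  have h0 := LinearMap.finrank_range_add_finrank_ker f.g0
  have h1 := LinearMap.finrank_range_add_finrank_ker f.g1
  rify at h0 h1
  have e0 : finrank ℂ ((top V).map f).S0 = finrank ℂ (LinearMap.range f.g0) :=
    congrArg (fun X : Submodule ℂ W.V0 => finrank ℂ X) (Submodule.map_top f.g0)
  have e1 : finrank ℂ ((top V).map f).S1 = finrank ℂ (LinearMap.range f.g1) :=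
    congrArg (fun X : Submodule ℂ W.V1 => finrank ℂ X) (Submodule.map_top f.g1)
  have k0 : finrank ℂ ((bot W).comap f).S0 = finrank ℂ (LinearMap.ker f.g0) := rfl
  have k1 : finrank ℂ ((bot W).comap f).S1 = finrank ℂ (LinearMap.ker f.g1) := rfl
  rw [wt, wt, e0, e1, k0, k1, QRep.wt, QRep.d0, QRep.d1]
  linear_combination ζ.1 * h0 + ζ.2 * h1

end QSub

namespace IsStableZero

variable {ζ : ℝ × ℝ} {V : QRep}

theorem isBot_or_isTop (h : IsStableZero ζ V) {S : QSub V} (hS : 0 ≤ S.wt ζ) :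
    S.IsBot ∨ S.IsTop := by
  by_contra! hc
  exact absurd (h.wt_neg S hc.1 hc.2) hS.not_gt

theorem wt_le (h : IsStableZero ζ V) (S : QSub V) : S.wt ζ ≤ 0 := by
  by_contra! hS
  rcases h.isBot_or_isTop hS.le with hb | ht
  · exact hS.ne' (hb.wt_eq ζ)
  · exact hS.ne' ((ht.wt_eq ζ).trans h.wt_eq)

/-- A nonzero morphism out of a stable representation is injective if its image has
nonpositive weight. -/
theorem injective_or_eq_zero (h : IsStableZero ζ V) {W : QRep} (f : QHom V W)
    (hW : ((QSub.top V).map f).wt ζ ≤ 0) :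
    (Function.Injective f.g0 ∧ Function.Injective f.g1) ∨ (f.g0 = 0 ∧ f.g1 = 0) := by
  have h1 := QSub.wt_ker_add_wt_range ζ f
  rw [h.wt_eq] at h1
  rcases h.isBot_or_isTop (S := (QSub.bot W).comap f) (by linarith) with hb | ht
  · left
    exact ⟨LinearMap.ker_eq_bot.1 hb.1, LinearMap.ker_eq_bot.1 hb.2.1⟩
  · right
    exact ⟨LinearMap.ker_eq_top.1 ht.1, LinearMap.ker_eq_top.1 ht.2.1⟩

theorem exists_eq_smul_id (h : IsStableZero ζ V) (f : QHom V V) :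
    ∃ c : ℂ, f.g0 = c • LinearMap.id ∧ f.g1 = c • LinearMap.id := by
  let g (c : ℂ) : QHom V V :=
    { g0 := f.g0 - c • LinearMap.id
      g1 := f.g1 - c • LinearMap.id
      gf := f.gf - c • LinearMap.id
      comm_a1 := by
        simp [LinearMap.sub_comp, LinearMap.comp_sub, f.comm_a1, LinearMap.smul_comp,
          LinearMap.comp_smul]
      comm_a2 := by
        simp [LinearMap.sub_comp, LinearMap.comp_sub, f.comm_a2, LinearMap.smul_comp,
          LinearMap.comp_smul]
      comm_b1 := by
        simp [LinearMap.sub_comp, LinearMap.comp_sub, f.comm_b1, LinearMap.smul_comp,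
          LinearMap.comp_smul]
      comm_b2 := by
        simp [LinearMap.sub_comp, LinearMap.comp_sub, f.comm_b2, LinearMap.smul_comp,
          LinearMap.comp_smul]
      comm_w := by
        simp [LinearMap.sub_comp, LinearMap.comp_sub, f.comm_w, LinearMap.smul_comp,
          LinearMap.comp_smul] }
  have hg (c : ℂ) := h.injective_or_eq_zero (g c) (h.wt_le _)
  have key (c : ℂ) (hc : ¬ (Function.Injective (g c).g0 ∧ Function.Injective (g c).g1)) :
      ∃ c : ℂ, f.g0 = c • LinearMap.id ∧ f.g1 = c • LinearMap.id := by
    obtain ⟨h0, h1⟩ := (hg c).resolve_left hc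
    exact ⟨c, sub_eq_zero.1 h0, sub_eq_zero.1 h1⟩
  by_cases hd : V.d0 = 0
  · have : Nontrivial V.V1 := finrank_pos_iff.1 (by have := h.dim_pos; rwa [hd, zero_add] at this)
    obtain ⟨c, hc⟩ := Module.End.exists_eigenvalue f.g1
    obtain ⟨v, hv, hv0⟩ := hc.exists_hasEigenvector
    refine key c fun hi => hv0 (hi.2 ?_)
    simp [g, Module.End.mem_eigenspace_iff.1 hv]
  · have : Nontrivial V.V0 := finrank_pos_iff.1 (Nat.pos_of_ne_zero hd)
    obtain ⟨c, hc⟩ := Module.End.exists_eigenvalue f.g0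
    obtain ⟨v, hv, hv0⟩ := hc.exists_hasEigenvector
    refine key c fun hi => hv0 (hi.1 ?_)
    simp [g, Module.End.mem_eigenspace_iff.1 hv]

theorem snd_nonneg (h : IsStableZero ζ V) (hζ : ζ.1 < ζ.2) : 0 ≤ ζ.2 := by
  by_contra! hc
  have h1 := h.wt_eq
  have h2 : (0 : ℝ) < V.d0 + V.d1 := by exact_mod_cast h.dim_pos
  simp only [QRep.wt] at h1
  have h3 : (0 : ℝ) ≤ V.d0 := by positivity
  have h4 : (0 : ℝ) ≤ V.d1 := by positivity
  nlinarith

theorem eq_zero_of_b_comp (h : IsStableZero ζ V) (hζ : 0 ≤ ζ.2) {α : V.V0 →ₗ[ℂ] V.V1}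
    (hα : ∀ j, V.b j ∘ₗ α = 0) : α = 0 := by
  let S : QSub V := QSub.ofPair ⊥ (LinearMap.ker V.b1 ⊓ LinearMap.ker V.b2) (by simp) (by simp)
    (fun x hx => hx.1) (fun x hx => hx.2)
  have hS : 0 ≤ S.wt ζ := by
    have : finrank ℂ S.S0 = 0 := finrank_bot ℂ V.V0
    rw [QSub.wt, this]
    simp only [Nat.cast_zero, mul_zero, zero_add]
    positivity
  rcases h.isBot_or_isTop hS with hb | ht
  · ext x
    have : α x ∈ S.S1 := ⟨LinearMap.congr_fun (hα 0) x, LinearMap.congr_fun (hα 1) x⟩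
    rwa [hb.2.1] at this
  · ext x
    have : x ∈ S.S0 := by rw [ht.1]; trivial
    have : x = 0 := this
    simp [this]

/-- A linear map whose composites with the arrows `b j` act as scalars vanishes, as soon as the
two vertices have different dimensions. -/
theorem eq_zero_of_b_comp_eq_smul (h : IsStableZero ζ V) (hζ : 0 ≤ ζ.2) (hd : V.d0 ≠ V.d1)
    {α : V.V0 →ₗ[ℂ] V.V1}
    (hα : ∀ j, ∃ c : ℂ, V.b j ∘ₗ α = c • LinearMap.id ∧ α ∘ₗ V.b j = c • LinearMap.id) :
    α = 0 := by
  refine h.eq_zero_of_b_comp hζ fun j => ?_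
  obtain ⟨c, h0, h1⟩ := hα j
  by_cases hc : c = 0
  · rw [h0, hc, zero_smul]
  · refine absurd (LinearEquiv.finrank_eq (LinearEquiv.ofLinearMap α (c⁻¹ • V.b j) ?_ ?_)) hd
    · rw [LinearMap.comp_smul, h1, smul_smul, inv_mul_cancel₀ hc, one_smul]
    · rw [LinearMap.smul_comp, h0, smul_smul, inv_mul_cancel₀ hc, one_smul]

theorem a_eq_zero (h : IsStableZero ζ V) (hζ : ζ.1 < ζ.2) (hd : V.d0 ≠ V.d1) (i : Fin 2) :
    V.a i = 0 :=
  h.eq_zero_of_b_comp_eq_smul (h.snd_nonneg hζ) hd fun j =>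
    h.exists_eq_smul_id (V.loop h.unframed i j)

theorem exists_smul_of_isKronHom (h : IsStableZero ζ V) (ha : ∀ i, V.a i = 0)
    {f0 : V.V0 →ₗ[ℂ] V.V0} {f1 : V.V1 →ₗ[ℂ] V.V1} (hf : QRep.IsKronHom V V f0 f1) :
    ∃ c : ℂ, f0 = c • LinearMap.id ∧ f1 = c • LinearMap.id :=
  h.exists_eq_smul_id (QRep.homOfKron ha ha h.unframed hf)

theorem dim_le_of_lt (h : IsStableZero ζ V) (hζ : ζ.1 < ζ.2) :
    V.d0 ≤ V.d1 + 1 ∧ V.d1 ≤ V.d0 + 1 := by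
  by_cases hd : V.d0 = V.d1
  · omega
  have ha := h.a_eq_zero hζ hd
  have h1 : finrank ℂ (LinearMap.ker (QRep.kronDiff V V)) ≤ 1 := by
    refine finrank_le_one ⟨(LinearMap.id, LinearMap.id),
      QRep.mem_ker_kronDiff.2 fun j => rfl⟩ fun f => ?_
    obtain ⟨c, h0, h1⟩ := h.exists_smul_of_isKronHom ha (QRep.mem_ker_kronDiff.1 f.2)
    exact ⟨c, Subtype.ext (Prod.ext h0.symm h1.symm)⟩
  have h2 := QRep.le_finrank_ker_kronDiff V V
  constructor
  · by_contra! hc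
    obtain ⟨e, he⟩ := Nat.exists_eq_add_of_lt hc
    rw [he] at h2
    nlinarith
  · by_contra! hc
    obtain ⟨e, he⟩ := Nat.exists_eq_add_of_lt hc
    rw [he] at h2
    nlinarith

theorem swap (h : IsStableZero ζ V) : IsStableZero ζ.swap V.swap where
  unframed := finrank_zero_of_subsingleton (M := PUnit)
  dim_pos := by rw [add_comm]; exact h.dim_pos
  wt_eq := by rw [← h.wt_eq]; exact add_comm _ _
  wt_neg S hb ht := by
    have : Subsingleton V.Vf := finrank_zero_iff.1 h.unframed
    have := h.wt_neg (QSub.ofPair S.S1 S.S0 S.hb1 S.hb2 S.ha1 S.ha2)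
      (fun hb' => hb ⟨hb'.2.1, hb'.1, Subsingleton.elim (α := Submodule ℂ PUnit) _ _⟩)
      (fun hb' => ht ⟨hb'.2.1, hb'.1, Subsingleton.elim (α := Submodule ℂ PUnit) _ _⟩)
    rw [QSub.wt, add_comm] at this
    exact this

theorem dim_le (h : IsStableZero ζ V) (hζ : ζ.1 ≠ ζ.2) :
    V.d0 ≤ V.d1 + 1 ∧ V.d1 ≤ V.d0 + 1 := by
  rcases hζ.lt_or_gt with h' | h'
  · exact h.dim_le_of_lt h'
  · exact (h.swap.dim_le_of_lt h').symm

end IsStableZero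

/-! ### Semistable unframed representations -/

namespace QRep

/-- The condition that a pair of subspaces is stable under the arrows `b1` and `b2`. -/
def IsKronSub (V : QRep) (S0 : Submodule ℂ V.V0) (S1 : Submodule ℂ V.V1) : Prop :=
  ∀ j, ∀ x ∈ S1, V.b j x ∈ S0

/-- The linear map out of a power with given components. -/
def rowMap {A B : Type} [AddCommGroup A] [AddCommGroup B] [Module ℂ A] [Module ℂ B] {k : ℕ}
    (f : Fin k → A →ₗ[ℂ] B) : (Fin k → A) →ₗ[ℂ] B :=
  ∑ j, f j ∘ₗ LinearMap.proj j

theorem rowMap_apply {A B : Type} [AddCommGroup A] [AddCommGroup B] [Module ℂ A] [Module ℂ B]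
    {k : ℕ} (f : Fin k → A →ₗ[ℂ] B) (x : Fin k → A) : rowMap f x = ∑ j, f j (x j) := by
  simp [rowMap]

theorem rowMap_b {V W : QRep} {k : ℕ} {F : Fin k → (V.V0 →ₗ[ℂ] W.V0) × (V.V1 →ₗ[ℂ] W.V1)}
    (hF : ∀ j, IsKronHom V W (F j).1 (F j).2) (i : Fin 2) (x : Fin k → V.V1) :
    rowMap (fun j => (F j).1) (fun j => V.b i (x j)) = W.b i (rowMap (fun j => (F j).2) x) := by
  simp only [rowMap_apply, map_sum]
  exact Finset.sum_congr rfl fun j _ => (hF j).apply i (x j)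

end QRep

theorem IsSemistableZero.wt_le_of_isKronSub {ζ : ℝ × ℝ} {Q : QRep} (h : IsSemistableZero ζ Q)
    (hζ : 0 ≤ ζ.2) {S0 : Submodule ℂ Q.V0} {S1 : Submodule ℂ Q.V1} (hS : Q.IsKronSub S0 S1) :
    ζ.1 * (finrank ℂ S0 : ℝ) + ζ.2 * (finrank ℂ S1 : ℝ) ≤ 0 := by
  obtain ⟨⟨T0, T1⟩, hT, hmax⟩ := exists_lex_max
    (fun p : Submodule ℂ Q.V0 × Submodule ℂ Q.V1 => Q.IsKronSub p.1 p.2) ⟨(S0, S1), hS⟩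
    (fun p => finrank ℂ p.1) (fun p => finrank ℂ p.2) _ _
    (fun p => Submodule.finrank_le p.1) (fun p => Submodule.finrank_le p.2)
    (fun m n => ζ.1 * m + ζ.2 * n) (fun m n => m + n)
  refine (hmax (S0, S1) hS).1.trans ?_
  dsimp only at hT hmax ⊢
  have hinv (i j : Fin 2) : ∀ x ∈ T0, Q.b j (Q.a i x) ∈ T0 := by
    set f0 := Q.b j ∘ₗ Q.a i with hf0
    set f1 := Q.a i ∘ₗ Q.b j with hf1
    have hf : QRep.IsKronHom Q Q f0 f1 := Q.isKronHom_loop i j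
    have hsup : Q.IsKronSub (T0 ⊔ T0.map f0) (T1 ⊔ T1.map f1) := by
      intro k x hx
      obtain ⟨y, hy, _, ⟨z, hz, rfl⟩, rfl⟩ := Submodule.mem_sup.1 hx
      rw [map_add, ← hf.apply]
      exact Submodule.add_mem_sup (hT k y hy) ⟨_, hT k z hz, rfl⟩
    have hinf : Q.IsKronSub (T0 ⊓ T0.comap f0) (T1 ⊓ T1.comap f1) := by
      intro k x hx
      refine ⟨hT k x hx.1, ?_⟩
      change f0 (Q.b k x) ∈ T0
      rw [hf.apply]
      exact hT k _ hx.2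
    have e0 := finrank_sup_map_add_finrank_inf_comap f0 T0
    have e1 := finrank_sup_map_add_finrank_inf_comap f1 T1
    have m1 := hmax (_, _) hsup
    have m2 := (hmax (_, _) hinf).1
    dsimp only at m1 m2
    rify at e0 e1
    have eq : ζ.1 * (finrank ℂ ↥(T0 ⊔ T0.map f0) : ℝ) + ζ.2 * (finrank ℂ ↥(T1 ⊔ T1.map f1) : ℝ) +
        (ζ.1 * (finrank ℂ ↥(T0 ⊓ T0.comap f0) : ℝ) +
          ζ.2 * (finrank ℂ ↥(T1 ⊓ T1.comap f1) : ℝ)) =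
        2 * (ζ.1 * (finrank ℂ T0 : ℝ) + ζ.2 * (finrank ℂ T1 : ℝ)) := by
      linear_combination ζ.1 * e0 + ζ.2 * e1
    have m3 := m1.2 (by linarith [m1.1])
    have l0 := Submodule.finrank_mono (le_sup_left : T0 ≤ T0 ⊔ T0.map f0)
    have l1 := Submodule.finrank_mono (le_sup_left : T1 ≤ T1 ⊔ T1.map f1)
    norm_cast at m3
    have := Submodule.eq_of_le_of_finrank_eq (le_sup_left : T0 ≤ T0 ⊔ T0.map f0) (by omega)
    intro x hx
    rw [this]
    exact le_sup_right (α := Submodule ℂ Q.V0) ⟨x, hx, rfl⟩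
  have hmem (i : Fin 2) : ∀ x ∈ T0, Q.a i x ∈ T1 ⊔ (T0.map (Q.a 0) ⊔ T0.map (Q.a 1)) := by
    intro x hx
    refine le_sup_right (α := Submodule ℂ Q.V1) ?_
    fin_cases i
    · exact le_sup_left (α := Submodule ℂ Q.V1) ⟨x, hx, rfl⟩
    · exact le_sup_right (α := Submodule ℂ Q.V1) ⟨x, hx, rfl⟩
  have hmem' (j : Fin 2) : ∀ x ∈ T1 ⊔ (T0.map (Q.a 0) ⊔ T0.map (Q.a 1)), Q.b j x ∈ T0 := by
    intro x hx
    obtain ⟨y, hy, z, hz, rfl⟩ := Submodule.mem_sup.1 hx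
    obtain ⟨_, ⟨u, hu, rfl⟩, _, ⟨v, hv, rfl⟩, rfl⟩ := Submodule.mem_sup.1 hz
    rw [map_add, map_add]
    exact add_mem (hT j y hy) (add_mem (hinv 0 j u hu) (hinv 1 j v hv))
  have hle : _ ≤ (0 : ℝ) := h.wt_le (QSub.ofPair T0 _ (hmem 0) (hmem 1) (hmem' 0) (hmem' 1))
  refine le_trans ?_ hle
  have := Submodule.finrank_mono (le_sup_left : T1 ≤ T1 ⊔ (T0.map (Q.a 0) ⊔ T0.map (Q.a 1)))
  exact add_le_add le_rfl (mul_le_mul_of_nonneg_left (by exact_mod_cast this) hζ)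

theorem IsStableZero.injective_rowMap {ζ : ℝ × ℝ} {C Q : QRep} (h : IsStableZero ζ C)
    (ha : ∀ i, C.a i = 0)
    (hQ : ∀ S0 S1, Q.IsKronSub S0 S1 →
      ζ.1 * (finrank ℂ S0 : ℝ) + ζ.2 * (finrank ℂ S1 : ℝ) ≤ 0) {k : ℕ}
    {F : Fin k → (C.V0 →ₗ[ℂ] Q.V0) × (C.V1 →ₗ[ℂ] Q.V1)}
    (hF : ∀ j, QRep.IsKronHom C Q (F j).1 (F j).2) (hli : LinearIndependent ℂ F) :
    Function.Injective (QRep.rowMap fun j => (F j).1) ∧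
      Function.Injective (QRep.rowMap fun j => (F j).2) := by
  induction k with
  | zero => exact ⟨Function.injective_of_subsingleton _, Function.injective_of_subsingleton _⟩
  | succ n ih =>
    rw [linearIndependent_finSucc] at hli
    obtain ⟨hli, hspan⟩ := hli
    have hF' (j) : QRep.IsKronHom C Q (Fin.tail F j).1 (Fin.tail F j).2 := hF j.succ
    obtain ⟨i0, i1⟩ := ih hF' hli
    set e0 := QRep.rowMap fun j => (Fin.tail F j).1 with he0
    set e1 := QRep.rowMap fun j => (Fin.tail F j).2 with he1
    have hR : Q.IsKronSub (LinearMap.range e0) (LinearMap.range e1) := by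
      rintro j _ ⟨x, rfl⟩
      exact ⟨_, QRep.rowMap_b hF' j x⟩
    have hsup : Q.IsKronSub (LinearMap.range e0 ⊔ LinearMap.range (F 0).1)
        (LinearMap.range e1 ⊔ LinearMap.range (F 0).2) := by
      intro k x hx
      obtain ⟨y, hy, _, ⟨z, rfl⟩, rfl⟩ := Submodule.mem_sup.1 hx
      rw [map_add, ← (hF 0).apply]
      exact Submodule.add_mem_sup (hR k y hy) ⟨_, rfl⟩
    have hD0 (i : Fin 2) : ∀ x ∈ (LinearMap.range e0).comap (F 0).1,
        C.a i x ∈ (LinearMap.range e1).comap (F 0).2 := fun x _ => by simp [ha i]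
    have hD1 (j : Fin 2) : ∀ x ∈ (LinearMap.range e1).comap (F 0).2,
        C.b j x ∈ (LinearMap.range e0).comap (F 0).1 := fun x hx => by
      rw [Submodule.mem_comap, (hF 0).apply]
      exact hR j _ hx
    let D : QSub C := QSub.ofPair _ _ (hD0 0) (hD0 1) (hD1 0) (hD1 1)
    have hD : 0 ≤ D.wt ζ := by
      have h1 := hQ _ _ hsup
      have h2 := h.wt_eq
      have f0 := finrank_sup_range_add_finrank_comap (F 0).1 (LinearMap.range e0)
      have f1 := finrank_sup_range_add_finrank_comap (F 0).2 (LinearMap.range e1)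
      rw [LinearMap.finrank_range_of_inj i0, finrank_pi_fintype] at f0
      rw [LinearMap.finrank_range_of_inj i1, finrank_pi_fintype] at f1
      simp only [Finset.sum_const, Finset.card_univ, Fintype.card_fin, smul_eq_mul] at f0 f1
      rify at f0 f1
      have hDw : D.wt ζ = ζ.1 * (finrank ℂ ((LinearMap.range e0).comap (F 0).1) : ℝ) +
        ζ.2 * (finrank ℂ ((LinearMap.range e1).comap (F 0).2) : ℝ) := rfl
      simp only [QRep.wt, QRep.d0, QRep.d1] at h2
      rw [hDw]
      linear_combination h1 - ζ.1 * f0 - ζ.2 * f1 - (n + 1 : ℝ) * h2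
    rcases h.isBot_or_isTop hD with hb | ht
    · constructor
      · rw [injective_iff_map_eq_zero]
        intro x hx
        rw [QRep.rowMap_apply, Fin.sum_univ_succ] at hx
        have hx' : (F 0).1 (x 0) + e0 (fun j => x j.succ) = 0 := by
          rw [he0, QRep.rowMap_apply]; exact hx
        have h0 : x 0 ∈ D.S0 := ⟨-(fun j => x j.succ), by
          rw [map_neg]; exact neg_eq_of_add_eq_zero_left hx'⟩
        rw [hb.1, Submodule.mem_bot] at h0
        rw [h0, map_zero, zero_add] at hx'
        have := i0 (hx'.trans (map_zero e0).symm)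
        exact funext fun j => Fin.cases h0 (fun j => congrFun this j) j
      · rw [injective_iff_map_eq_zero]
        intro x hx
        rw [QRep.rowMap_apply, Fin.sum_univ_succ] at hx
        have hx' : (F 0).2 (x 0) + e1 (fun j => x j.succ) = 0 := by
          rw [he1, QRep.rowMap_apply]; exact hx
        have h0 : x 0 ∈ D.S1 := ⟨-(fun j => x j.succ), by
          rw [map_neg]; exact neg_eq_of_add_eq_zero_left hx'⟩
        rw [hb.2.1, Submodule.mem_bot] at h0
        rw [h0, map_zero, zero_add] at hx'
        have := i1 (hx'.trans (map_zero e1).symm)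
        exact funext fun j => Fin.cases h0 (fun j => congrFun this j) j
    · exfalso
      have t0 : LinearMap.range (F 0).1 ≤ LinearMap.range e0 := by
        rintro _ ⟨x, rfl⟩
        have : x ∈ D.S0 := by rw [ht.1]; trivial
        exact this
      have t1 : LinearMap.range (F 0).2 ≤ LinearMap.range e1 := by
        rintro _ ⟨x, rfl⟩
        have : x ∈ D.S1 := by rw [ht.2.1]; trivial
        exact this
      obtain ⟨g0, hg0⟩ := exists_lift_of_range_le i0 t0
      obtain ⟨g1, hg1⟩ := exists_lift_of_range_le i1 t1
      have hg (j) : QRep.IsKronHom C C (LinearMap.proj j ∘ₗ g0) (LinearMap.proj j ∘ₗ g1) := by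
        intro i
        ext x
        have : e0 (g0 (C.b i x)) = e0 (fun j => C.b i (g1 x j)) := by
          rw [he0, QRep.rowMap_b hF' i (g1 x), ← he0, ← he1]
          have a0 := LinearMap.congr_fun hg0 (C.b i x)
          have a1 := LinearMap.congr_fun hg1 x
          simp only [LinearMap.comp_apply] at a0 a1
          rw [a0, a1, (hF 0).apply]
        exact congrFun (i0 this) j
      choose c hc0 hc1 using fun j => h.exists_smul_of_isKronHom ha (hg j)
      refine hspan ?_
      have : F 0 = ∑ j, c j • Fin.tail F j := by
        refine Prod.ext ?_ ?_
        · rw [Prod.fst_sum, ← hg0]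
          ext x
          rw [LinearMap.comp_apply, he0, QRep.rowMap_apply, LinearMap.sum_apply]
          refine Finset.sum_congr rfl fun j _ => ?_
          have : g0 x j = c j • x := LinearMap.congr_fun (hc0 j) x
          rw [this, map_smul, Prod.smul_fst, LinearMap.smul_apply]
        · rw [Prod.snd_sum, ← hg1]
          ext x
          rw [LinearMap.comp_apply, he1, QRep.rowMap_apply, LinearMap.sum_apply]
          refine Finset.sum_congr rfl fun j _ => ?_
          have : g1 x j = c j • x := LinearMap.congr_fun (hc1 j) x
          rw [this, map_smul, Prod.smul_snd, LinearMap.smul_apply]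
      rw [this]
      exact sum_mem fun j _ => Submodule.smul_mem _ _ (Submodule.subset_span ⟨j, rfl⟩)

/-- Dimension vectors of weight zero are multiples of that of a stable representation of weight
zero. -/
theorem exists_nat_mul_of_wt_eq_zero {ζ : ℝ × ℝ} (hζ : ζ.1 + ζ.2 ≠ 0) {c0 c1 q0 q1 : ℕ}
    (h1 : c0 ≤ c1 + 1) (h2 : c1 ≤ c0 + 1) (hc : 0 < c0 + c1)
    (hcw : ζ.1 * (c0 : ℝ) + ζ.2 * (c1 : ℝ) = 0) (hqw : ζ.1 * (q0 : ℝ) + ζ.2 * (q1 : ℝ) = 0) :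
    (c0 = c1 + 1 ∨ c1 = c0 + 1) ∧ ∃ k, q0 = k * c0 ∧ q1 = k * c1 := by
  have hne : c0 ≠ c1 := by
    rintro rfl
    have : (c0 : ℝ) ≠ 0 := by exact_mod_cast (by omega : c0 ≠ 0)
    exact hζ ((mul_eq_zero_iff_right this).1 (by linear_combination hcw))
  have hcross : q0 * c1 = q1 * c0 := by
    have a1 : ζ.1 * ((q0 : ℝ) * c1 - q1 * c0) = 0 := by
      linear_combination (c1 : ℝ) * hqw - (q1 : ℝ) * hcw
    have a2 : ζ.2 * ((q0 : ℝ) * c1 - q1 * c0) = 0 := by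
      linear_combination (q0 : ℝ) * hcw - (c0 : ℝ) * hqw
    have : (ζ.1 + ζ.2) * ((q0 : ℝ) * c1 - q1 * c0) = 0 := by linear_combination a1 + a2
    have := (mul_eq_zero.1 this).resolve_left hζ
    rw [sub_eq_zero] at this
    exact_mod_cast this
  have hcase : c0 = c1 + 1 ∨ c1 = c0 + 1 := by omega
  refine ⟨hcase, ?_⟩
  rcases hcase with rfl | rfl
  · have : q1 ≤ q0 := by
      by_contra! hlt
      nlinarith
    obtain ⟨k, rfl⟩ := Nat.exists_eq_add_of_le this
    exact ⟨k, by linarith, by linarith⟩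
  · have : q0 ≤ q1 := by
      by_contra! hlt
      nlinarith
    obtain ⟨k, rfl⟩ := Nat.exists_eq_add_of_le this
    exact ⟨k, by linarith, by linarith⟩

theorem IsSemistableZero.exists_qIso_pow_of_lt {ζ : ℝ × ℝ} {C Q : QRep} (hQ : IsSemistableZero ζ Q)
    (hC : IsStableZero ζ C) (hlt : ζ.1 < ζ.2) (hζ : ζ.1 + ζ.2 ≠ 0) :
    ∃ k, QIso (C.pow k) Q := by
  have hd := hC.dim_le_of_lt hlt
  have h2 := hC.snd_nonneg hlt
  obtain ⟨hcase, k, hk0, hk1⟩ :=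
    exists_nat_mul_of_wt_eq_zero hζ hd.1 hd.2 hC.dim_pos hC.wt_eq hQ.wt_eq
  have hne : C.d0 ≠ C.d1 := by omega
  have ha := hC.a_eq_zero hlt hne
  have hker : k ≤ finrank ℂ (LinearMap.ker (QRep.kronDiff C Q)) := by
    have := QRep.le_finrank_ker_kronDiff C Q
    rw [hk0, hk1] at this
    rcases hcase with h | h
    · rw [h] at this
      nlinarith
    · rw [h] at this
      nlinarith
  obtain ⟨F, hF⟩ := exists_linearIndependent_of_le_finrank hker
  have hF' := hF.map' _ (Submodule.ker_subtype _)
  have hkron (j) : QRep.IsKronHom C Q (F j).1.1 (F j).1.2 := QRep.mem_ker_kronDiff.1 (F j).2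
  obtain ⟨i0, i1⟩ := hC.injective_rowMap ha (fun S0 S1 hS => hQ.wt_le_of_isKronSub h2 hS)
    (F := fun j => (F j).1) hkron hF'
  have n0 : finrank ℂ (Fin k → C.V0) = finrank ℂ Q.V0 := by
    rw [finrank_pi_fintype]
    simpa [QRep.d0] using hk0.symm
  have n1 : finrank ℂ (Fin k → C.V1) = finrank ℂ Q.V1 := by
    rw [finrank_pi_fintype]
    simpa [QRep.d1] using hk1.symm
  have b0 := (⟨i0, (LinearMap.injective_iff_surjective_of_finrank_eq_finrank n0).1 i0⟩ :
    Function.Bijective _)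
  have b1 := (⟨i1, (LinearMap.injective_iff_surjective_of_finrank_eq_finrank n1).1 i1⟩ :
    Function.Bijective _)
  let E0 := LinearEquiv.ofBijective _ b0
  let E1 := LinearEquiv.ofBijective _ b1
  have hE (i : Fin 2) (x : Fin k → C.V1) : E0 (fun j => C.b i (x j)) = Q.b i (E1 x) :=
    QRep.rowMap_b hkron i x
  have hE' (i : Fin 2) (y : Q.V1) : E0.symm (Q.b i y) = fun j => C.b i (E1.symm y j) := by
    rw [LinearEquiv.symm_apply_eq, hE, LinearEquiv.apply_symm_apply]
  have haQ (i) : Q.a i = 0 := by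
    have hα : E1.symm.toLinearMap ∘ₗ Q.a i ∘ₗ E0.toLinearMap = 0 := by
      refine LinearMap.pi_ext' fun l => LinearMap.ext fun x => funext fun m => ?_
      let α : C.V0 →ₗ[ℂ] C.V1 := LinearMap.proj m ∘ₗ E1.symm.toLinearMap ∘ₗ Q.a i ∘ₗ
        E0.toLinearMap ∘ₗ LinearMap.single ℂ (fun _ => C.V0) l
      have hloop (j n) (y : C.V1) : C.b j (α (C.b n y)) =
          E0.symm (Q.b j (Q.a i (Q.b n (E1 (Pi.single l y))))) m := by
        have : E0 (Pi.single l (C.b n y)) = Q.b n (E1 (Pi.single l y)) := by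
          rw [← hE]
          congr 1
          exact Pi.single_op (fun _ => C.b n) (fun _ => map_zero _) l y |>.symm ▸ rfl
        rw [hE', ← this]
        rfl
      have : α = 0 := hC.eq_zero_of_b_comp_eq_smul h2 hne fun j => by
        refine hC.exists_smul_of_isKronHom ha fun n => LinearMap.ext fun y => ?_
        change C.b j (α (C.b n y)) = C.b n (α (C.b j y))
        rw [hloop, hloop, Q.b_a_b]
      exact LinearMap.congr_fun this x
    ext x
    obtain ⟨y, rfl⟩ := E0.surjective x
    have := LinearMap.congr_fun hα y
    simpa using this
  have hpa (i) : (C.pow k).a i = 0 := by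
    have h0 := ha 0
    have h1 := ha 1
    simp only [QRep.a_zero, QRep.a_one] at h0 h1
    fin_cases i
    · exact LinearMap.ext fun x => funext fun j => LinearMap.congr_fun h0 (x j)
    · exact LinearMap.ext fun x => funext fun j => LinearMap.congr_fun h1 (x j)
  have : Subsingleton C.Vf := finrank_zero_iff.1 hC.unframed
  have hs1 : Subsingleton (C.pow k).Vf := inferInstanceAs (Subsingleton (Fin k → C.Vf))
  have hs2 : Subsingleton Q.Vf := finrank_zero_iff.1 hQ.unframed
  refine ⟨k, QRep.homOfKron (V := C.pow k) (f0 := E0.toLinearMap) (f1 := E1.toLinearMap) hpa haQ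
    (finrank_zero_iff.2 hs1) (fun i => LinearMap.ext fun x => ?_), b0, b1,
    Function.injective_of_subsingleton _, fun x => ⟨0, Subsingleton.elim _ _⟩⟩
  change E0 ((C.pow k).b i x) = Q.b i (E1 x)
  refine Eq.trans ?_ (hE i x)
  fin_cases i <;> rfl

theorem IsSemistableZero.swap {ζ : ℝ × ℝ} {Q : QRep} (h : IsSemistableZero ζ Q) :
    IsSemistableZero ζ.swap Q.swap where
  unframed := finrank_zero_of_subsingleton (M := PUnit)
  wt_eq := by rw [← h.wt_eq]; exact add_comm _ _
  wt_le S := by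
    have := h.wt_le (QSub.ofPair S.S1 S.S0 S.hb1 S.hb2 S.ha1 S.ha2)
    rw [QSub.wt, add_comm] at this
    exact this

/-- A semistable representation of weight zero is a direct sum of copies of a given stable
representation of weight zero. -/
theorem IsSemistableZero.exists_qIso_pow {ζ : ℝ × ℝ} {C Q : QRep} (hQ : IsSemistableZero ζ Q)
    (hC : IsStableZero ζ C) (hne : ζ.1 ≠ ζ.2) (hζ : ζ.1 + ζ.2 ≠ 0) :
    ∃ k, QIso (C.pow k) Q := by
  rcases hne.lt_or_gt with h | h
  · exact hQ.exists_qIso_pow_of_lt hC h hζ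
  obtain ⟨k, f, h0, h1, -⟩ := hQ.swap.exists_qIso_pow_of_lt hC.swap h (by rwa [add_comm] at hζ)
  have : Subsingleton C.Vf := finrank_zero_iff.1 hC.unframed
  have hs1 : Subsingleton (C.pow k).Vf := inferInstanceAs (Subsingleton (Fin k → C.Vf))
  have hs2 : Subsingleton Q.Vf := finrank_zero_iff.1 hQ.unframed
  exact ⟨k, ⟨f.g1, f.g0, 0, f.comm_b1, f.comm_b2, f.comm_a1, f.comm_a2,
    LinearMap.ext fun x => by simp [Subsingleton.elim x 0]⟩, h1, h0,
    Function.injective_of_subsingleton _, fun x => ⟨0, Subsingleton.elim _ _⟩⟩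

/-! ### Walls -/

theorem OnWall.exists_int {ζ : ℝ × ℝ} {m : ℕ} (h : OnWall ζ m) :
    ζ.1 ≠ ζ.2 ∧ ∃ r : ℤ, (r : ℝ) * ζ.1 + (r - 1) * ζ.2 = 0 := by
  rcases h with ⟨-, h, e⟩ | ⟨h, e⟩ | ⟨-, h, e⟩ | ⟨h, e⟩
  · exact ⟨h.ne, m, by exact_mod_cast e⟩
  · exact ⟨h.ne, -m, by push_cast; linear_combination -e⟩
  · exact ⟨h.ne', m, by exact_mod_cast e⟩
  · exact ⟨h.ne', -m, by push_cast; linear_combination -e⟩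

theorem OnWall.add_ne_zero {ζ : ℝ × ℝ} {m : ℕ} (h : OnWall ζ m) : ζ.1 + ζ.2 ≠ 0 := by
  obtain ⟨hne, r, hr⟩ := h.exists_int
  intro h0
  have h2 : ζ.2 = 0 := by linear_combination r * h0 - hr
  exact hne (by linarith)

/-- Close to a wall, the weight of a stable unframed representation cannot change sign. -/
theorem OnWall.exists_gap {ζ : ℝ × ℝ} {m : ℕ} (h : OnWall ζ m) :
    ∃ ε₀ > (0 : ℝ), ∀ V : QRep, finrank ℂ V.Vf = 0 → 0 < V.d0 + V.d1 → IsStableUn ζ V →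
      V.wt ζ ≠ 0 → ε₀ * (V.d0 + V.d1 : ℕ) ≤ |V.wt ζ| := by
  obtain ⟨hne, r, hr⟩ := h.exists_int
  have hσ : 0 < |ζ.1 + ζ.2| := abs_pos.2 h.add_ne_zero
  have hr' : (0 : ℝ) < 2 * |(r : ℝ)| + 3 := by positivity
  refine ⟨|ζ.1 + ζ.2| / (2 * |(r : ℝ)| + 3), by positivity, fun V hf hd hst hwt => ?_⟩
  obtain ⟨l0, l1⟩ := (hst.isStableZero hf hd).dim_le (by simpa using hne)
  set M : ℤ := V.d0 + r * (V.d1 - V.d0) with hM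
  have hwM : V.wt ζ = (ζ.1 + ζ.2) * M := by
    rw [hM, QRep.wt]
    push_cast
    linear_combination ((V.d0 : ℝ) - V.d1) * hr
  have hM1 : 1 ≤ |M| := by
    refine Int.one_le_abs fun h0 => ?_
    simp [hwM, h0] at hwt
  have he : |(V.d1 : ℤ) - V.d0| ≤ 1 := abs_le.2 ⟨by omega, by omega⟩
  have hN : ((V.d0 + V.d1 : ℕ) : ℤ) ≤ (2 * |r| + 3) * |M| := by
    have e1 : ((V.d0 + V.d1 : ℕ) : ℤ) =
        2 * M + (-(2 * (r * (V.d1 - V.d0))) + (V.d1 - V.d0)) := by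
      push_cast
      rw [hM]
      ring
    have e2 : |r * ((V.d1 : ℤ) - V.d0)| ≤ |r| := by
      rw [abs_mul]
      exact mul_le_of_le_one_right (abs_nonneg _) he
    have e3 := neg_abs_le (r * ((V.d1 : ℤ) - V.d0))
    have e4 := le_abs_self M
    have e5 := le_abs_self ((V.d1 : ℤ) - V.d0)
    have e6 : (2 * |r| + 1) * 1 ≤ (2 * |r| + 1) * |M| :=
      mul_le_mul_of_nonneg_left hM1 (by positivity)
    rw [e1]
    linarith
  have hN' : ((V.d0 + V.d1 : ℕ) : ℝ) ≤ (2 * |(r : ℝ)| + 3) * |(M : ℝ)| := by exact_mod_cast hN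
  rw [hwM, abs_mul, div_mul_eq_mul_div, div_le_iff₀ hr']
  nlinarith

/-! ### Framed stability -/

theorem Submodule.eq_bot_or_eq_top_of_finrank_eq_one {V : Type*} [AddCommGroup V] [Module ℂ V]
    [FiniteDimensional ℂ V] (h : finrank ℂ V = 1) (S : Submodule ℂ V) : S = ⊥ ∨ S = ⊤ := by
  have := S.finrank_le
  rcases Nat.eq_zero_or_pos (finrank ℂ S) with h0 | h0
  · exact .inl (Submodule.finrank_eq_zero.1 h0)
  · exact .inr (Submodule.eq_top_of_finrank_eq (by omega))

theorem isStableFr_iff {ζ : ℝ × ℝ} {V : QRep} (hf : finrank ℂ V.Vf = 1) :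
    IsStableFr ζ V ↔ (∀ S : QSub V, S.Sf = ⊥ → ¬ S.IsBot → S.wt ζ < 0) ∧
      ∀ S : QSub V, S.Sf = ⊤ → ¬ S.IsTop → S.wt ζ < V.wt ζ := by
  have htop : slopeQ (ζ.1, ζ.2, -(ζ.1 * V.d0 + ζ.2 * V.d1)) V.d0 V.d1 V.df = 0 := by
    simp [slopeQ, QRep.df, hf]
  have hbot' (S : QSub V) (hS : S.Sf = ⊥) (hb : ¬ S.IsBot) :
      slopeQ (ζ.1, ζ.2, -(ζ.1 * V.d0 + ζ.2 * V.d1)) (finrank ℂ S.S0) (finrank ℂ S.S1)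
        (finrank ℂ S.Sf) < 0 ↔ S.wt ζ < 0 := by
    have h0 : finrank ℂ S.Sf = 0 := Submodule.finrank_eq_zero.2 hS
    have h1 : (0 : ℝ) < (finrank ℂ S.S0 : ℝ) + finrank ℂ S.S1 := by
      exact_mod_cast QSub.dim_pos hS hb
    simp [slopeQ, h0, div_lt_iff₀ h1, QSub.wt]
  have htop' (S : QSub V) (hS : S.Sf = ⊤) :
      slopeQ (ζ.1, ζ.2, -(ζ.1 * V.d0 + ζ.2 * V.d1)) (finrank ℂ S.S0) (finrank ℂ S.S1)
        (finrank ℂ S.Sf) < 0 ↔ S.wt ζ < V.wt ζ := by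
    have h0 : finrank ℂ S.Sf = 1 := (congrArg (fun X : Submodule ℂ _ => finrank ℂ X) hS).trans
      ((finrank_top _ _).trans hf)
    have h1 : (0 : ℝ) < (finrank ℂ S.S0 : ℝ) + finrank ℂ S.S1 + 1 := by positivity
    simp only [slopeQ, h0, QSub.wt, QRep.wt, Nat.cast_one, div_lt_iff₀ h1, zero_mul]
    constructor <;> intro h <;> linarith
  have hbt : (⊥ : Submodule ℂ V.Vf) ≠ ⊤ := by
    intro h
    have := congrArg (fun X : Submodule ℂ V.Vf => finrank ℂ X) h
    simp [hf] at this
  rw [IsStableFr, IsStableQ, htop]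
  constructor
  · refine fun h => ⟨fun S hS hb => (hbot' S hS hb).1 (h S hb fun ht => ?_),
      fun S hS ht => (htop' S hS).1 (h S (fun hb => ?_) ht)⟩
    · exact hbt (hS.symm.trans ht.2.2)
    · exact hbt (hb.2.2.symm.trans hS)
  · rintro ⟨h1, h2⟩ S hb ht
    rcases Submodule.eq_bot_or_eq_top_of_finrank_eq_one hf S.Sf with hS | hS
    · exact (hbot' S hS hb).2 (h1 S hS hb)
    · exact (htop' S hS).2 (h2 S hS ht)

namespace QSub

variable {V W : QRep}

theorem isBot_map {f : QHom V W} (h0 : Function.Injective f.g0) (h1 : Function.Injective f.g1)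
    (hf : Function.Injective f.gf) {T : QSub V} : (T.map f).IsBot ↔ T.IsBot := by
  have key {A B : Type} [AddCommGroup A] [AddCommGroup B] [Module ℂ A] [Module ℂ B]
      {g : A →ₗ[ℂ] B} (hg : Function.Injective g) (S : Submodule ℂ A) : S.map g = ⊥ ↔ S = ⊥ := by
    rw [← Submodule.map_bot g, (Submodule.map_injective_of_injective hg).eq_iff]
  exact and_congr (key h0 _) (and_congr (key h1 _) (key hf _))

theorem isTop_comap {f : QHom V W} (h0 : Function.Surjective f.g0)
    (h1 : Function.Surjective f.g1) (hf : Function.Surjective f.gf) {T : QSub W} :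
    (T.comap f).IsTop ↔ T.IsTop := by
  have key {A B : Type} [AddCommGroup A] [AddCommGroup B] [Module ℂ A] [Module ℂ B]
      {g : A →ₗ[ℂ] B} (hg : Function.Surjective g) (S : Submodule ℂ B) :
      S.comap g = ⊤ ↔ S = ⊤ := by
    rw [← Submodule.comap_top g, (Submodule.comap_injective_of_surjective hg).eq_iff]
  exact and_congr (key h0 _) (and_congr (key h1 _) (key hf _))

theorem Sf_map_of_eq_bot {f : QHom V W} {T : QSub V} (hT : T.Sf = ⊥) : (T.map f).Sf = ⊥ := by
  rw [map_Sf, hT, Submodule.map_bot]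

theorem Sf_map_of_eq_top {f : QHom V W} (hf : LinearMap.range f.gf = ⊤) {T : QSub V}
    (hT : T.Sf = ⊤) : (T.map f).Sf = ⊤ := by
  rw [map_Sf, hT, Submodule.map_top, hf]

theorem Sf_comap_of_eq_top {f : QHom V W} {T : QSub W} (hT : T.Sf = ⊤) :
    (T.comap f).Sf = ⊤ := by
  rw [comap_Sf, hT, Submodule.comap_top]

theorem Sf_comap_of_eq_bot {f : QHom V W} (hf : LinearMap.ker f.gf = ⊥) {T : QSub W}
    (hT : T.Sf = ⊥) : (T.comap f).Sf = ⊥ := by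
  rw [comap_Sf, hT, Submodule.comap_bot, hf]

variable {S : QSub V}

theorem isBot_map_incl {T : QSub S.toRep} : (T.map S.incl).IsBot ↔ T.IsBot :=
  isBot_map S.S0.subtype_injective S.S1.subtype_injective S.Sf.subtype_injective

theorem isTop_comap_proj {T : QSub S.quot} : (T.comap S.proj).IsTop ↔ T.IsTop :=
  isTop_comap S.S0.mkQ_surjective S.S1.mkQ_surjective S.Sf.mkQ_surjective

theorem range_gf_incl (S : QSub V) : LinearMap.range S.incl.gf = S.Sf :=
  S.Sf.range_subtype

theorem ker_gf_proj (S : QSub V) : LinearMap.ker S.proj.gf = S.Sf :=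
  S.Sf.ker_mkQ

theorem finrank_Vf_quot (S : QSub V) :
    finrank ℂ S.quot.Vf + finrank ℂ S.Sf = finrank ℂ V.Vf :=
  S.Sf.finrank_quotient_add_finrank

theorem dim_quot (S : QSub V) : S.quot.d0 + S.quot.d1 + S.dim = V.d0 + V.d1 := by
  have := S.d0_quot
  have := S.d1_quot
  rw [dim]
  omega

theorem Sf_eq_top_of_subsingleton {Q : QRep} (hf : finrank ℂ Q.Vf = 0) (T : QSub Q) :
    T.Sf = ⊤ := by
  have : Subsingleton Q.Vf := finrank_zero_iff.1 hf
  exact Subsingleton.elim _ _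

theorem Sf_eq_bot_of_subsingleton {Q : QRep} (hf : finrank ℂ Q.Vf = 0) (T : QSub Q) :
    T.Sf = ⊥ := by
  have : Subsingleton Q.Vf := finrank_zero_iff.1 hf
  exact Subsingleton.elim _ _

theorem finrank_Sf_of_eq_top (hS : S.Sf = ⊤) : finrank ℂ S.Sf = finrank ℂ V.Vf :=
  (congrArg (fun X : Submodule ℂ _ => finrank ℂ X) hS).trans (finrank_top _ _)

theorem finrank_Sf_of_eq_bot (hS : S.Sf = ⊥) : finrank ℂ S.Sf = 0 :=
  Submodule.finrank_eq_zero.2 hS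

end QSub

/-- The weight of a stable unframed representation does not change sign when moving off `ζ`
by `ε`. -/
def HasGap (ζ : ℝ × ℝ) (ε : ℝ) : Prop :=
  ∀ V : QRep, finrank ℂ V.Vf = 0 → 0 < V.d0 + V.d1 → IsStableUn ζ V →
    V.wt ζ ≠ 0 → ε * (V.d0 + V.d1 : ℕ) < |V.wt ζ|

section

variable {ζ : ℝ × ℝ} {ε : ℝ} {E : QRep}

theorem IsStableFr.wt_le_of_add (hE : finrank ℂ E.Vf = 1)
    (hst : IsStableFr (ζ.1 + ε, ζ.2 + ε) E) (hgap : HasGap ζ ε) {S : QSub E} (hS : S.Sf = ⊤) :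
    S.wt ζ ≤ E.wt ζ := by
  by_contra! hlt
  have hSt : ¬ S.IsTop := fun h => hlt.ne' (h.wt_eq ζ)
  obtain ⟨R, ⟨hR, hRt⟩, hmax⟩ := exists_lex_max (fun T : QSub E => T.Sf = ⊤ ∧ ¬ T.IsTop)
    ⟨S, hS, hSt⟩ (fun T => finrank ℂ T.S0) (fun T => finrank ℂ T.S1) _ _
    QSub.finrank_S0_le QSub.finrank_S1_le
    (fun m n => (ζ.1 * m + ζ.2 * n - E.wt ζ) / ((E.d0 + E.d1 : ℕ) - (m + n : ℕ)))
    (fun m n => (m + n : ℕ))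
  change ∀ T : QSub E, T.Sf = ⊤ ∧ ¬ T.IsTop →
    (T.wt ζ - E.wt ζ) / ((E.d0 + E.d1 : ℕ) - (T.dim : ℝ)) ≤
      (R.wt ζ - E.wt ζ) / ((E.d0 + E.d1 : ℕ) - (R.dim : ℝ)) ∧
    ((T.wt ζ - E.wt ζ) / ((E.d0 + E.d1 : ℕ) - (T.dim : ℝ)) =
      (R.wt ζ - E.wt ζ) / ((E.d0 + E.d1 : ℕ) - (R.dim : ℝ)) → (T.dim : ℝ) ≤ (R.dim : ℝ)) at hmax
  have hpos (T : QSub E) (hT : T.Sf = ⊤) (hTt : ¬ T.IsTop) :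
      0 < ((E.d0 + E.d1 : ℕ) : ℝ) - (T.dim : ℝ) := by
    rw [sub_pos]
    exact_mod_cast QSub.dim_lt hT hTt
  have hRwt : E.wt ζ < R.wt ζ := by
    have h1 := (hmax S ⟨hS, hSt⟩).1
    have h2 : 0 < (S.wt ζ - E.wt ζ) / ((E.d0 + E.d1 : ℕ) - (S.dim : ℝ)) :=
      div_pos (sub_pos.2 hlt) (hpos S hS hSt)
    have h3 := (div_pos_iff_of_pos_right (hpos R hR hRt)).1 (h2.trans_le h1)
    linarith
  have hdim := R.dim_quot
  have hdim' : ((R.quot.d0 + R.quot.d1 : ℕ) : ℝ) = (E.d0 + E.d1 : ℕ) - (R.dim : ℝ) := by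
    rw [eq_sub_iff_add_eq]
    exact_mod_cast hdim
  have hQf : finrank ℂ R.quot.Vf = 0 := by
    have := R.finrank_Vf_quot
    rw [QSub.finrank_Sf_of_eq_top hR] at this
    omega
  have hQ : IsStableUn ζ R.quot := by
    rw [isStableUn_iff hQf]
    intro T hb ht
    have hT := QSub.dim_pos (T.Sf_eq_bot_of_subsingleton hQf) hb
    have hTf := QSub.Sf_comap_of_eq_top (f := R.proj) (T.Sf_eq_top_of_subsingleton hQf)
    have hTt := mt QSub.isTop_comap_proj.1 ht
    have h1 := hmax _ ⟨hTf, hTt⟩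
    have h2 := h1.1.lt_of_ne fun h => by
      have := h1.2 h
      rw [QSub.dim_comap_proj] at this
      norm_cast at this
      omega
    rw [div_lt_div_iff₀ (hpos _ hTf hTt) (hpos R hR hRt), QSub.wt_comap_proj,
      QSub.dim_comap_proj] at h2
    rw [hdim', QSub.wt_quot, div_lt_div_iff₀ (by exact_mod_cast hT) (hpos R hR hRt)]
    push_cast at h2 ⊢
    linarith
  have h1 := hgap R.quot hQf (by have := QSub.dim_lt hR hRt; omega) hQ
    (by rw [QSub.wt_quot]; linarith)
  have h2 := ((isStableFr_iff hE).1 hst).2 R hR hRt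
  rw [QSub.wt_add_smul, QRep.wt_add_smul] at h2
  rw [QSub.wt_quot, abs_of_neg (by linarith), hdim'] at h1
  linarith

theorem IsStableFr.wt_nonpos_of_sub (hE : finrank ℂ E.Vf = 1)
    (hst : IsStableFr (ζ.1 - ε, ζ.2 - ε) E) (hgap : HasGap ζ ε) {S : QSub E} (hS : S.Sf = ⊥) :
    S.wt ζ ≤ 0 := by
  by_contra! hlt
  have hSb : ¬ S.IsBot := fun h => hlt.ne' (h.wt_eq ζ)
  obtain ⟨R, ⟨hR, hRb⟩, hmax⟩ := exists_lex_max (fun T : QSub E => T.Sf = ⊥ ∧ ¬ T.IsBot)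
    ⟨S, hS, hSb⟩ (fun T => finrank ℂ T.S0) (fun T => finrank ℂ T.S1) _ _
    QSub.finrank_S0_le QSub.finrank_S1_le
    (fun m n => (ζ.1 * m + ζ.2 * n) / (m + n : ℕ)) (fun m n => -(m + n : ℕ))
  change ∀ T : QSub E, T.Sf = ⊥ ∧ ¬ T.IsBot →
    T.wt ζ / T.dim ≤ R.wt ζ / R.dim ∧
      (T.wt ζ / T.dim = R.wt ζ / R.dim → -(T.dim : ℝ) ≤ -(R.dim : ℝ)) at hmax
  have hpos (T : QSub E) (hT : T.Sf = ⊥) (hTb : ¬ T.IsBot) : 0 < (T.dim : ℝ) := by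
    exact_mod_cast QSub.dim_pos hT hTb
  have hRwt : 0 < R.wt ζ := (div_pos_iff_of_pos_right (hpos R hR hRb)).1
    ((div_pos hlt (hpos S hS hSb)).trans_le (hmax S ⟨hS, hSb⟩).1)
  have hQf : finrank ℂ R.toRep.Vf = 0 := QSub.finrank_Sf_of_eq_bot hR
  have hQ : IsStableUn ζ R.toRep := by
    rw [isStableUn_iff hQf]
    intro T hb ht
    have hT := QSub.dim_lt (T.Sf_eq_top_of_subsingleton hQf) ht
    have hTf := QSub.Sf_map_of_eq_bot (f := R.incl) (T.Sf_eq_bot_of_subsingleton hQf)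
    have hTb := mt QSub.isBot_map_incl.1 hb
    have h1 := hmax _ ⟨hTf, hTb⟩
    have h2 := h1.1.lt_of_ne fun h => by
      have := h1.2 h
      rw [QSub.dim_map_incl, neg_le_neg_iff] at this
      norm_cast at this
      exact absurd hT this.not_gt
    rwa [QSub.dim_map_incl, QSub.wt_map_incl] at h2
  have h1 := hgap R.toRep hQf (QSub.dim_pos hR hRb) hQ hRwt.ne'
  have h2 := ((isStableFr_iff hE).1 hst).1 R hR hRb
  rw [sub_eq_add_neg, sub_eq_add_neg, QSub.wt_add_smul] at h2
  change ε * R.dim < |R.wt ζ| at h1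
  rw [abs_of_pos hRwt] at h1
  linarith

theorem IsStableFr.exists_sub_of_add (hε : 0 < ε) (hE : finrank ℂ E.Vf = 1)
    (hst : IsStableFr (ζ.1 + ε, ζ.2 + ε) E) (hgap : HasGap ζ ε) :
    ∃ S : QSub E, finrank ℂ S.toRep.Vf = 1 ∧ IsStableFr ζ S.toRep ∧ IsSemistableZero ζ S.quot := by
  obtain ⟨S, ⟨hS, hSE⟩, hmax⟩ := exists_lex_max (fun T : QSub E => T.Sf = ⊤ ∧ T.wt ζ = E.wt ζ)
    ⟨QSub.top E, rfl, QSub.wt_top ζ⟩ (fun T => finrank ℂ T.S0) (fun T => finrank ℂ T.S1) _ _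
    QSub.finrank_S0_le QSub.finrank_S1_le (fun m n => -(m + n : ℕ)) (fun _ _ => 0)
  have hf : finrank ℂ S.toRep.Vf = 1 := (QSub.finrank_Sf_of_eq_top hS).trans hE
  have hQf : finrank ℂ S.quot.Vf = 0 := by
    have := S.finrank_Vf_quot
    rw [QSub.finrank_Sf_of_eq_top hS] at this
    omega
  refine ⟨S, hf, (isStableFr_iff hf).2 ⟨fun T hT hb => ?_, fun T hT ht => ?_⟩, hQf, ?_,
    fun T => ?_⟩
  · have h1 := ((isStableFr_iff hE).1 hst).1 (T.map S.incl) (QSub.Sf_map_of_eq_bot hT)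
      (mt QSub.isBot_map_incl.1 hb)
    rw [QSub.wt_add_smul, QSub.wt_map_incl] at h1
    have : 0 ≤ ε * (T.map S.incl).dim := by positivity
    linarith
  · have hT' := QSub.Sf_map_of_eq_top (S.range_gf_incl.trans hS) hT
    have h1 := hst.wt_le_of_add hE hgap hT'
    rw [QSub.wt_map_incl, ← hSE] at h1
    refine lt_of_le_of_ne h1 fun h => ?_
    have h2 := (hmax (T.map S.incl) ⟨hT', by rw [QSub.wt_map_incl, ← hSE]; exact h⟩).1
    change -((T.map S.incl).dim : ℝ) ≤ -(S.dim : ℝ) at h2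
    rw [neg_le_neg_iff, QSub.dim_map_incl] at h2
    norm_cast at h2
    exact absurd (QSub.dim_lt hT ht) h2.not_gt
  · rw [QSub.wt_quot, hSE, sub_self]
  · have := hst.wt_le_of_add hE hgap
      (QSub.Sf_comap_of_eq_top (f := S.proj) (T.Sf_eq_top_of_subsingleton hQf))
    rw [QSub.wt_comap_proj] at this
    linarith

theorem IsStableFr.exists_sub_of_sub (hε : 0 < ε) (hE : finrank ℂ E.Vf = 1)
    (hst : IsStableFr (ζ.1 - ε, ζ.2 - ε) E) (hgap : HasGap ζ ε) :
    ∃ S : QSub E, finrank ℂ S.quot.Vf = 1 ∧ IsStableFr ζ S.quot ∧ IsSemistableZero ζ S.toRep := by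
  obtain ⟨S, ⟨hS, hSE⟩, hmax⟩ := exists_lex_max (fun T : QSub E => T.Sf = ⊥ ∧ T.wt ζ = 0)
    ⟨QSub.bot E, rfl, QSub.wt_bot ζ⟩ (fun T => finrank ℂ T.S0) (fun T => finrank ℂ T.S1) _ _
    QSub.finrank_S0_le QSub.finrank_S1_le (fun m n => (m + n : ℕ)) (fun _ _ => 0)
  have hf : finrank ℂ S.quot.Vf = 1 := by
    have := S.finrank_Vf_quot
    rw [QSub.finrank_Sf_of_eq_bot hS] at this
    omega
  refine ⟨S, hf, (isStableFr_iff hf).2 ⟨fun T hT hb => ?_, fun T hT ht => ?_⟩,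
    QSub.finrank_Sf_of_eq_bot hS, hSE, fun T => ?_⟩
  · have hT' := QSub.Sf_comap_of_eq_bot (S.ker_gf_proj.trans hS) hT
    have h1 := hst.wt_nonpos_of_sub hE hgap hT'
    rw [QSub.wt_comap_proj, hSE, add_zero] at h1
    refine lt_of_le_of_ne h1 fun h => ?_
    have h2 := (hmax (T.comap S.proj) ⟨hT', by rw [QSub.wt_comap_proj, hSE, h, add_zero]⟩).1
    change ((T.comap S.proj).dim : ℝ) ≤ (S.dim : ℝ) at h2
    rw [QSub.dim_comap_proj] at h2
    norm_cast at h2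
    have := QSub.dim_pos hT hb
    omega
  · have hT' := QSub.Sf_comap_of_eq_top (f := S.proj) hT
    have ht' := mt QSub.isTop_comap_proj.1 ht
    have h1 := ((isStableFr_iff hE).1 hst).2 (T.comap S.proj) hT' ht'
    have h2 : ((T.comap S.proj).dim : ℝ) < (E.d0 + E.d1 : ℕ) := by
      exact_mod_cast QSub.dim_lt hT' ht'
    rw [sub_eq_add_neg, sub_eq_add_neg, QSub.wt_add_smul, QRep.wt_add_smul, QSub.wt_comap_proj,
      hSE] at h1
    rw [QSub.wt_quot, hSE]
    nlinarith
  · rw [← QSub.wt_map_incl]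
    exact hst.wt_nonpos_of_sub hE hgap (QSub.Sf_map_of_eq_bot
      (T.Sf_eq_bot_of_subsingleton (QSub.finrank_Sf_of_eq_bot hS)))

end

/-! ### Morphisms -/

namespace QHom

variable {U V W : QRep}

/-- The identity morphism. -/
def id (V : QRep) : QHom V V where
  g0 := LinearMap.id
  g1 := LinearMap.id
  gf := LinearMap.id
  comm_a1 := rfl
  comm_a2 := rfl
  comm_b1 := rfl
  comm_b2 := rfl
  comm_w := rfl

/-- The composition of two morphisms. -/
@[simps]
def comp (g : QHom V W) (f : QHom U V) : QHom U W where
  g0 := g.g0 ∘ₗ f.g0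
  g1 := g.g1 ∘ₗ f.g1
  gf := g.gf ∘ₗ f.gf
  comm_a1 := by rw [LinearMap.comp_assoc, f.comm_a1, ← LinearMap.comp_assoc, g.comm_a1,
    LinearMap.comp_assoc]
  comm_a2 := by rw [LinearMap.comp_assoc, f.comm_a2, ← LinearMap.comp_assoc, g.comm_a2,
    LinearMap.comp_assoc]
  comm_b1 := by rw [LinearMap.comp_assoc, f.comm_b1, ← LinearMap.comp_assoc, g.comm_b1,
    LinearMap.comp_assoc]
  comm_b2 := by rw [LinearMap.comp_assoc, f.comm_b2, ← LinearMap.comp_assoc, g.comm_b2,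
    LinearMap.comp_assoc]
  comm_w := by rw [LinearMap.comp_assoc, f.comm_w, ← LinearMap.comp_assoc, g.comm_w,
    LinearMap.comp_assoc]

theorem pmap_diag {A B : Type} [AddCommGroup A] [AddCommGroup B] [Module ℂ A] [Module ℂ B]
    {k : ℕ} (c : Fin k → ℂ) (f : A →ₗ[ℂ] B) :
    pmap k f ∘ₗ (LinearMap.pi fun j => c j • LinearMap.id : A →ₗ[ℂ] Fin k → A) =
      (LinearMap.pi fun j => c j • LinearMap.id : B →ₗ[ℂ] Fin k → B) ∘ₗ f := by
  ext x
  simp [pmap]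

/-- The diagonal morphism `x ↦ (c j • x)` into a power. -/
@[simps]
def diag (C : QRep) {k : ℕ} (c : Fin k → ℂ) : QHom C (C.pow k) where
  g0 := (LinearMap.pi fun j => c j • LinearMap.id : C.V0 →ₗ[ℂ] Fin k → C.V0)
  g1 := (LinearMap.pi fun j => c j • LinearMap.id : C.V1 →ₗ[ℂ] Fin k → C.V1)
  gf := (LinearMap.pi fun j => c j • LinearMap.id : C.Vf →ₗ[ℂ] Fin k → C.Vf)
  comm_a1 := (pmap_diag c C.a1).symm
  comm_a2 := (pmap_diag c C.a2).symm
  comm_b1 := (pmap_diag c C.b1).symm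
  comm_b2 := (pmap_diag c C.b2).symm
  comm_w := (pmap_diag c C.w).symm

theorem pmap_comb {A B : Type} [AddCommGroup A] [AddCommGroup B] [Module ℂ A] [Module ℂ B]
    {k : ℕ} (c : Fin k → ℂ) (f : A →ₗ[ℂ] B) :
    (∑ j, c j • LinearMap.proj j : (Fin k → B) →ₗ[ℂ] B) ∘ₗ pmap k f =
      f ∘ₗ (∑ j, c j • LinearMap.proj j : (Fin k → A) →ₗ[ℂ] A) := by
  ext x
  simp [pmap]

/-- The morphism `x ↦ ∑ j, c j • x j` from a power. -/
@[simps]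
def comb (C : QRep) {k : ℕ} (c : Fin k → ℂ) : QHom (C.pow k) C where
  g0 := (∑ j, c j • LinearMap.proj j : (Fin k → C.V0) →ₗ[ℂ] C.V0)
  g1 := (∑ j, c j • LinearMap.proj j : (Fin k → C.V1) →ₗ[ℂ] C.V1)
  gf := (∑ j, c j • LinearMap.proj j : (Fin k → C.Vf) →ₗ[ℂ] C.Vf)
  comm_a1 := pmap_comb c C.a1
  comm_a2 := pmap_comb c C.a2
  comm_b1 := pmap_comb c C.b1
  comm_b2 := pmap_comb c C.b2
  comm_w := pmap_comb c C.w

theorem exists_lift {i : QHom U W} {j : QHom V W} (h0 : Function.Injective j.g0)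
    (h1 : Function.Injective j.g1) (hf : Function.Injective j.gf)
    (r0 : LinearMap.range i.g0 ≤ LinearMap.range j.g0)
    (r1 : LinearMap.range i.g1 ≤ LinearMap.range j.g1)
    (rf : LinearMap.range i.gf ≤ LinearMap.range j.gf) :
    ∃ g : QHom U V, j.g0 ∘ₗ g.g0 = i.g0 ∧ j.g1 ∘ₗ g.g1 = i.g1 ∧ j.gf ∘ₗ g.gf = i.gf := by
  obtain ⟨g0, e0⟩ := exists_lift_of_range_le h0 r0
  obtain ⟨g1, e1⟩ := exists_lift_of_range_le h1 r1
  obtain ⟨gf, ef⟩ := exists_lift_of_range_le hf rf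
  have key {A A' B B' X X' : Type} [AddCommGroup A] [AddCommGroup B] [AddCommGroup A']
      [AddCommGroup B'] [AddCommGroup X] [AddCommGroup X'] [Module ℂ A] [Module ℂ B]
      [Module ℂ A'] [Module ℂ B'] [Module ℂ X] [Module ℂ X'] {i : A →ₗ[ℂ] X} {i' : A' →ₗ[ℂ] X'}
      {j : B →ₗ[ℂ] X} {j' : B' →ₗ[ℂ] X'} {g : A →ₗ[ℂ] B} {g' : A' →ₗ[ℂ] B'}
      {α : A →ₗ[ℂ] A'} {β : B →ₗ[ℂ] B'} {γ : X →ₗ[ℂ] X'} (hj : Function.Injective j')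
      (e : j ∘ₗ g = i) (e' : j' ∘ₗ g' = i') (ci : i' ∘ₗ α = γ ∘ₗ i) (cj : j' ∘ₗ β = γ ∘ₗ j) :
      g' ∘ₗ α = β ∘ₗ g := by
    rw [← LinearMap.cancel_left hj, ← LinearMap.comp_assoc, e', ci, ← LinearMap.comp_assoc, cj,
      LinearMap.comp_assoc, e]
  exact ⟨⟨g0, g1, gf, key h1 e0 e1 i.comm_a1 j.comm_a1, key h1 e0 e1 i.comm_a2 j.comm_a2,
    key h0 e1 e0 i.comm_b1 j.comm_b1, key h0 e1 e0 i.comm_b2 j.comm_b2,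
    key h0 ef e0 i.comm_w j.comm_w⟩, e0, e1, ef⟩

theorem exists_desc {p : QHom U V} {q : QHom U W} (h0 : Function.Surjective p.g0)
    (h1 : Function.Surjective p.g1) (hf : Function.Surjective p.gf)
    (r0 : LinearMap.ker p.g0 ≤ LinearMap.ker q.g0)
    (r1 : LinearMap.ker p.g1 ≤ LinearMap.ker q.g1)
    (rf : LinearMap.ker p.gf ≤ LinearMap.ker q.gf) :
    ∃ g : QHom V W, g.g0 ∘ₗ p.g0 = q.g0 ∧ g.g1 ∘ₗ p.g1 = q.g1 ∧ g.gf ∘ₗ p.gf = q.gf := by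
  obtain ⟨g0, e0⟩ := exists_desc_of_ker_le h0 r0
  obtain ⟨g1, e1⟩ := exists_desc_of_ker_le h1 r1
  obtain ⟨gf, ef⟩ := exists_desc_of_ker_le hf rf
  have key {A A' B B' X X' : Type} [AddCommGroup A] [AddCommGroup B] [AddCommGroup A']
      [AddCommGroup B'] [AddCommGroup X] [AddCommGroup X'] [Module ℂ A] [Module ℂ B]
      [Module ℂ A'] [Module ℂ B'] [Module ℂ X] [Module ℂ X'] {p : X →ₗ[ℂ] A} {p' : X' →ₗ[ℂ] A'}
      {q : X →ₗ[ℂ] B} {q' : X' →ₗ[ℂ] B'} {g : A →ₗ[ℂ] B} {g' : A' →ₗ[ℂ] B'}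
      {α : A →ₗ[ℂ] A'} {β : B →ₗ[ℂ] B'} {γ : X →ₗ[ℂ] X'} (hp : Function.Surjective p)
      (e : g ∘ₗ p = q) (e' : g' ∘ₗ p' = q') (cp : p' ∘ₗ γ = α ∘ₗ p) (cq : q' ∘ₗ γ = β ∘ₗ q) :
      g' ∘ₗ α = β ∘ₗ g := by
    rw [← LinearMap.cancel_right hp, LinearMap.comp_assoc, ← cp, ← LinearMap.comp_assoc, e', cq,
      LinearMap.comp_assoc, e]
  exact ⟨⟨g0, g1, gf, key h0 e0 e1 p.comm_a1 q.comm_a1, key h0 e0 e1 p.comm_a2 q.comm_a2,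
    key h1 e1 e0 p.comm_b1 q.comm_b1, key h1 e1 e0 p.comm_b2 q.comm_b2,
    key hf ef e0 p.comm_w q.comm_w⟩, e0, e1, ef⟩

end QHom

theorem QIso.symm {V W : QRep} (h : QIso V W) : QIso W V := by
  obtain ⟨f, h0, h1, hf⟩ := h
  obtain ⟨g, e0, e1, ef⟩ := QHom.exists_desc (p := f) (q := QHom.id V) h0.2 h1.2 hf.2
    ((LinearMap.ker_eq_bot.2 h0.1).trans_le bot_le) ((LinearMap.ker_eq_bot.2 h1.1).trans_le bot_le)
    ((LinearMap.ker_eq_bot.2 hf.1).trans_le bot_le)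
  have key {A B : Type} [AddCommGroup A] [AddCommGroup B] [Module ℂ A] [Module ℂ B]
      {f : A →ₗ[ℂ] B} {g : B →ₗ[ℂ] A} (hf : Function.Bijective f) (e : g ∘ₗ f = LinearMap.id) :
      Function.Bijective g := by
    refine (Function.Bijective.of_comp_iff g hf).1 ?_
    rw [← LinearMap.coe_comp, e]
    exact Function.bijective_id
  exact ⟨g, key h0 e0, key h1 e1, key hf ef⟩

theorem QIso.of_injective {V W : QRep} {f : QHom V W} {g : QHom W V}
    (f0 : Function.Injective f.g0) (f1 : Function.Injective f.g1) (ff : Function.Injective f.gf)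
    (g0 : Function.Injective g.g0) (g1 : Function.Injective g.g1) (gf : Function.Injective g.gf) :
    QIso V W := by
  have key {A B : Type} [AddCommGroup A] [AddCommGroup B] [Module ℂ A] [Module ℂ B]
      [FiniteDimensional ℂ A] [FiniteDimensional ℂ B] {f : A →ₗ[ℂ] B} {g : B →ₗ[ℂ] A}
      (hf : Function.Injective f) (hg : Function.Injective g) : Function.Bijective f :=
    ⟨hf, (LinearMap.injective_iff_surjective_of_finrank_eq_finrank
      (le_antisymm (LinearMap.finrank_le_finrank_of_injective hf)
        (LinearMap.finrank_le_finrank_of_injective hg))).1 hf⟩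
  exact ⟨f, key f0 g0, key f1 g1, key ff gf⟩

theorem QIso.of_surjective {V W : QRep} {f : QHom V W} {g : QHom W V}
    (f0 : Function.Surjective f.g0) (f1 : Function.Surjective f.g1)
    (ff : Function.Surjective f.gf) (g0 : Function.Surjective g.g0)
    (g1 : Function.Surjective g.g1) (gf : Function.Surjective g.gf) : QIso V W := by
  have key {A B : Type} [AddCommGroup A] [AddCommGroup B] [Module ℂ A] [Module ℂ B]
      [FiniteDimensional ℂ A] [FiniteDimensional ℂ B] {f : A →ₗ[ℂ] B} {g : B →ₗ[ℂ] A}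
      (hf : Function.Surjective f) (hg : Function.Surjective g) : Function.Bijective f :=
    ⟨(LinearMap.injective_iff_surjective_of_finrank_eq_finrank
      (le_antisymm (LinearMap.finrank_le_finrank_of_surjective hg)
        (LinearMap.finrank_le_finrank_of_surjective hf))).2 hf, hf⟩
  exact ⟨f, key f0 g0, key f1 g1, key ff gf⟩

theorem QIso.dim_eq {V W : QRep} (h : QIso V W) : V.d0 = W.d0 ∧ V.d1 = W.d1 := by
  obtain ⟨f, h0, h1, -⟩ := h
  exact ⟨(LinearEquiv.ofBijective f.g0 h0).finrank_eq, (LinearEquiv.ofBijective f.g1 h1).finrank_eq⟩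

/-! ### Extensions -/

section

variable {T B E : QRep} {i : QHom B E} {p : QHom E T}

theorem QSub.isExactSeq (S : QSub E) : IsExactSeq S.incl S.proj := by
  refine ⟨S.S0.subtype_injective, S.S1.subtype_injective, S.Sf.subtype_injective,
    S.S0.mkQ_surjective, S.S1.mkQ_surjective, S.Sf.mkQ_surjective, ?_, ?_, ?_⟩
  · exact S.S0.range_subtype.trans S.S0.ker_mkQ.symm
  · exact S.S1.range_subtype.trans S.S1.ker_mkQ.symm
  · exact S.Sf.range_subtype.trans S.Sf.ker_mkQ.symm

theorem IsExactSeq.exists_of_qIso_right (h : IsExactSeq i p) {T' : QRep} (hT : QIso T T') :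
    ∃ p' : QHom E T', IsExactSeq i p' := by
  obtain ⟨i0, i1, i2, p0, p1, p2, e0, e1, e2⟩ := h
  obtain ⟨f, f0, f1, f2⟩ := hT
  refine ⟨f.comp p, i0, i1, i2, f0.2.comp p0, f1.2.comp p1, f2.2.comp p2, ?_, ?_, ?_⟩
  · rw [QHom.comp_g0, LinearMap.ker_comp_of_ker_eq_bot _ (LinearMap.ker_eq_bot.2 f0.1), e0]
  · rw [QHom.comp_g1, LinearMap.ker_comp_of_ker_eq_bot _ (LinearMap.ker_eq_bot.2 f1.1), e1]
  · rw [QHom.comp_gf, LinearMap.ker_comp_of_ker_eq_bot _ (LinearMap.ker_eq_bot.2 f2.1), e2]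

theorem IsExactSeq.exists_of_qIso_left (h : IsExactSeq i p) {B' : QRep} (hB : QIso B' B) :
    ∃ i' : QHom B' E, IsExactSeq i' p := by
  obtain ⟨i0, i1, i2, p0, p1, p2, e0, e1, e2⟩ := h
  obtain ⟨f, f0, f1, f2⟩ := hB
  refine ⟨i.comp f, i0.comp f0.1, i1.comp f1.1, i2.comp f2.1, p0, p1, p2, ?_, ?_, ?_⟩
  · rw [QHom.comp_g0, LinearMap.range_comp_of_range_eq_top _ (LinearMap.range_eq_top.2 f0.2), e0]
  · rw [QHom.comp_g1, LinearMap.range_comp_of_range_eq_top _ (LinearMap.range_eq_top.2 f1.2), e1]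
  · rw [QHom.comp_gf, LinearMap.range_comp_of_range_eq_top _ (LinearMap.range_eq_top.2 f2.2), e2]

theorem IsExactSeq.dim_eq (h : IsExactSeq i p) :
    B.d0 + T.d0 = E.d0 ∧ B.d1 + T.d1 = E.d1 := by
  obtain ⟨i0, i1, i2, p0, p1, p2, e0, e1, e2⟩ := h
  have h0 := LinearMap.finrank_range_add_finrank_ker p.g0
  have h1 := LinearMap.finrank_range_add_finrank_ker p.g1
  rw [← e0, LinearMap.finrank_range_of_inj i0, LinearMap.range_eq_top.2 p0, finrank_top] at h0
  rw [← e1, LinearMap.finrank_range_of_inj i1, LinearMap.range_eq_top.2 p1, finrank_top] at h1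
  exact ⟨by rw [QRep.d0, QRep.d0, QRep.d0]; omega, by rw [QRep.d1, QRep.d1, QRep.d1]; omega⟩

theorem IsExactSeq.wt_eq (h : IsExactSeq i p) (ζ : ℝ × ℝ) : B.wt ζ + T.wt ζ = E.wt ζ := by
  obtain ⟨h0, h1⟩ := h.dim_eq
  rify at h0 h1
  simp only [QRep.wt]
  linear_combination ζ.1 * h0 + ζ.2 * h1

theorem IsExactSeq.exists_realizesExt (h : IsExactSeq i p) :
    ∃ ξ : ExtCochain T B, RealizesExt i p ξ := by
  have h' := h
  obtain ⟨i0, i1, i2, p0, p1, p2, e0, e1, e2⟩ := h'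
  obtain ⟨s0, hs0⟩ := LinearMap.exists_rightInverse_of_surjective _ (LinearMap.range_eq_top.2 p0)
  obtain ⟨s1, hs1⟩ := LinearMap.exists_rightInverse_of_surjective _ (LinearMap.range_eq_top.2 p1)
  obtain ⟨s2, hs2⟩ := LinearMap.exists_rightInverse_of_surjective _ (LinearMap.range_eq_top.2 p2)
  have key {A A' B' X X' : Type} [AddCommGroup A] [AddCommGroup A'] [AddCommGroup B']
      [AddCommGroup X] [AddCommGroup X'] [Module ℂ A] [Module ℂ A'] [Module ℂ B'] [Module ℂ X]
      [Module ℂ X'] {p : X →ₗ[ℂ] A} {p' : X' →ₗ[ℂ] A'} {i : B' →ₗ[ℂ] X'} {s : A →ₗ[ℂ] X}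
      {s' : A' →ₗ[ℂ] X'} {α : A →ₗ[ℂ] A'} {γ : X →ₗ[ℂ] X'} (hi : Function.Injective i)
      (he : LinearMap.range i = LinearMap.ker p') (hp : p' ∘ₗ γ = α ∘ₗ p)
      (hs : p ∘ₗ s = LinearMap.id) (hs' : p' ∘ₗ s' = LinearMap.id) :
      ∃ ξ : A →ₗ[ℂ] B', i ∘ₗ ξ = γ ∘ₗ s - s' ∘ₗ α := by
    refine exists_lift_of_range_le hi ?_
    rw [he, LinearMap.range_le_ker_iff, LinearMap.comp_sub, ← LinearMap.comp_assoc, hp,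
      LinearMap.comp_assoc, hs, ← LinearMap.comp_assoc, hs', LinearMap.comp_id, LinearMap.id_comp,
      sub_self]
  obtain ⟨ξ1, h1⟩ := key i1 e1 p.comm_a1 hs0 hs1
  obtain ⟨ξ2, h2⟩ := key i1 e1 p.comm_a2 hs0 hs1
  obtain ⟨ξ3, h3⟩ := key i0 e0 p.comm_b1 hs1 hs0
  obtain ⟨ξ4, h4⟩ := key i0 e0 p.comm_b2 hs1 hs0
  obtain ⟨ξ5, h5⟩ := key i0 e0 p.comm_w hs2 hs0
  exact ⟨(ξ1, ξ2, ξ3, ξ4, ξ5), h, s0, s1, s2, hs0, hs1, hs2, h1, h2, h3, h4, h5⟩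

theorem RealizesExt.isECocycle {ξ : ExtCochain T B} (h : RealizesExt i p ξ) :
    IsECocycle T B ξ := by
  obtain ⟨⟨i0, i1, -⟩, s0, s1, s2, -, -, -, h1, h2, h3, h4, -⟩ := h
  have h1 := LinearMap.congr_fun h1
  have h2 := LinearMap.congr_fun h2
  have h3 := LinearMap.congr_fun h3
  have h4 := LinearMap.congr_fun h4
  have c1 := LinearMap.congr_fun i.comm_a1
  have c2 := LinearMap.congr_fun i.comm_a2
  have c3 := LinearMap.congr_fun i.comm_b1
  have c4 := LinearMap.congr_fun i.comm_b2
  have r1 := LinearMap.congr_fun E.rel1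
  have r2 := LinearMap.congr_fun E.rel2
  have r3 := LinearMap.congr_fun E.rel3
  have r4 := LinearMap.congr_fun E.rel4
  have t1 := LinearMap.congr_fun T.rel1
  have t2 := LinearMap.congr_fun T.rel2
  have t3 := LinearMap.congr_fun T.rel3
  have t4 := LinearMap.congr_fun T.rel4
  simp only [LinearMap.comp_apply, LinearMap.sub_apply] at h1 h2 h3 h4 c1 c2 c3 c4
  simp only [LinearMap.comp_apply] at r1 r2 r3 r4 t1 t2 t3 t4
  refine ⟨LinearMap.ext fun x => i0 ?_, LinearMap.ext fun x => i0 ?_, LinearMap.ext fun x => i1 ?_,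
    LinearMap.ext fun x => i1 ?_⟩ <;>
  simp only [LinearMap.comp_apply, LinearMap.add_apply, map_add, map_sub, h1, h2, h3, h4, c1, c2,
    c3, c4]
  · rw [r4, t4]; abel
  · rw [r3, t3]; abel
  · rw [r2, t2]; abel
  · rw [r1, t1]; abel

/-- The pullback of a cochain. -/
def ExtCochain.pull (ξ : ExtCochain T B) {T' : QRep} (f : QHom T' T) : ExtCochain T' B :=
  (ξ.1 ∘ₗ f.g0, ξ.2.1 ∘ₗ f.g0, ξ.2.2.1 ∘ₗ f.g1, ξ.2.2.2.1 ∘ₗ f.g1, ξ.2.2.2.2 ∘ₗ f.gf)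

/-- The pushforward of a cochain. -/
def ExtCochain.push (ξ : ExtCochain T B) {B' : QRep} (f : QHom B B') : ExtCochain T B' :=
  (f.g1 ∘ₗ ξ.1, f.g1 ∘ₗ ξ.2.1, f.g0 ∘ₗ ξ.2.2.1, f.g0 ∘ₗ ξ.2.2.2.1, f.g0 ∘ₗ ξ.2.2.2.2)

theorem IsECocycle.pull {ξ : ExtCochain T B} (h : IsECocycle T B ξ) {T' : QRep}
    (f : QHom T' T) : IsECocycle T' B (ExtCochain.pull ξ f) := by
  obtain ⟨h1, h2, h3, h4⟩ := h
  have c1 := LinearMap.congr_fun f.comm_a1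
  have c2 := LinearMap.congr_fun f.comm_a2
  have c3 := LinearMap.congr_fun f.comm_b1
  have c4 := LinearMap.congr_fun f.comm_b2
  simp only [LinearMap.comp_apply] at c1 c2 c3 c4
  refine ⟨LinearMap.ext fun x => ?_, LinearMap.ext fun x => ?_, LinearMap.ext fun x => ?_,
    LinearMap.ext fun x => ?_⟩ <;>
  simp only [ExtCochain.pull, LinearMap.comp_apply, LinearMap.add_apply, c1, c2, c3, c4]
  · exact LinearMap.congr_fun h1 (f.g1 x)
  · exact LinearMap.congr_fun h2 (f.g1 x)
  · exact LinearMap.congr_fun h3 (f.g0 x)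
  · exact LinearMap.congr_fun h4 (f.g0 x)

theorem IsECocycle.push {ξ : ExtCochain T B} (h : IsECocycle T B ξ) {B' : QRep}
    (f : QHom B B') : IsECocycle T B' (ExtCochain.push ξ f) := by
  obtain ⟨h1, h2, h3, h4⟩ := h
  have c1 := LinearMap.congr_fun f.comm_a1
  have c2 := LinearMap.congr_fun f.comm_a2
  have c3 := LinearMap.congr_fun f.comm_b1
  have c4 := LinearMap.congr_fun f.comm_b2
  simp only [LinearMap.comp_apply] at c1 c2 c3 c4
  refine ⟨LinearMap.ext fun x => ?_, LinearMap.ext fun x => ?_, LinearMap.ext fun x => ?_,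
    LinearMap.ext fun x => ?_⟩
  · have h := congrArg f.g0 (LinearMap.congr_fun h1 x)
    simpa only [ExtCochain.push, LinearMap.comp_apply, LinearMap.add_apply, map_add, c1, c2, c3,
      c4] using h
  · have h := congrArg f.g0 (LinearMap.congr_fun h2 x)
    simpa only [ExtCochain.push, LinearMap.comp_apply, LinearMap.add_apply, map_add, c1, c2, c3,
      c4] using h
  · have h := congrArg f.g1 (LinearMap.congr_fun h3 x)
    simpa only [ExtCochain.push, LinearMap.comp_apply, LinearMap.add_apply, map_add, c1, c2, c3,
      c4] using h
  · have h := congrArg f.g1 (LinearMap.congr_fun h4 x)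
    simpa only [ExtCochain.push, LinearMap.comp_apply, LinearMap.add_apply, map_add, c1, c2, c3,
      c4] using h

/-- A morphism to the quotient of an extension lifts if it pulls the extension class back to
zero. -/
theorem RealizesExt.exists_lift {ξ : ExtCochain T B} (h : RealizesExt i p ξ) {T' : QRep}
    {f : QHom T' T} (hf : IsECoboundary T' B (ExtCochain.pull ξ f)) :
    ∃ g : QHom T' E, p.g0 ∘ₗ g.g0 = f.g0 ∧ p.g1 ∘ₗ g.g1 = f.g1 := by
  obtain ⟨⟨-, -, -, -, -, -, e0, e1, -⟩, s0, s1, s2, hs0, hs1, -, h1, h2, h3, h4, h5⟩ := h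
  obtain ⟨η0, η1, η2, k1, k2, k3, k4, k5⟩ := hf
  have key {A A' B B' X X' Y Y' : Type} [AddCommGroup A] [AddCommGroup A'] [AddCommGroup B]
      [AddCommGroup B'] [AddCommGroup X] [AddCommGroup X'] [AddCommGroup Y] [AddCommGroup Y']
      [Module ℂ A] [Module ℂ A'] [Module ℂ B] [Module ℂ B'] [Module ℂ X] [Module ℂ X']
      [Module ℂ Y] [Module ℂ Y'] {α : A →ₗ[ℂ] A'} {β : B →ₗ[ℂ] B'} {γ : X →ₗ[ℂ] X'}
      {δ : Y →ₗ[ℂ] Y'} {i : B →ₗ[ℂ] X} {i' : B' →ₗ[ℂ] X'} {f : Y →ₗ[ℂ] A} {f' : Y' →ₗ[ℂ] A'}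
      {s : A →ₗ[ℂ] X} {s' : A' →ₗ[ℂ] X'} {ξ : A →ₗ[ℂ] B'} {η : Y →ₗ[ℂ] B} {η' : Y' →ₗ[ℂ] B'}
      (ci : i' ∘ₗ β = γ ∘ₗ i) (cf : f' ∘ₗ δ = α ∘ₗ f) (hξ : i' ∘ₗ ξ = γ ∘ₗ s - s' ∘ₗ α)
      (hη : ξ ∘ₗ f = β ∘ₗ η - η' ∘ₗ δ) :
      (s' ∘ₗ f' - i' ∘ₗ η') ∘ₗ δ = γ ∘ₗ (s ∘ₗ f - i ∘ₗ η) := by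
    ext y
    have ci := LinearMap.congr_fun ci (η y)
    have cf := LinearMap.congr_fun cf y
    have hξ := LinearMap.congr_fun hξ (f y)
    have hη := congrArg i' (LinearMap.congr_fun hη y)
    simp only [LinearMap.comp_apply, LinearMap.sub_apply, map_sub] at ci cf hξ hη ⊢
    rw [hξ, ci] at hη
    rw [cf, eq_sub_of_add_eq' (eq_sub_iff_add_eq.1 hη)]
    abel
  have key' {B X A Y : Type} [AddCommGroup A] [AddCommGroup B] [AddCommGroup X] [AddCommGroup Y]
      [Module ℂ A] [Module ℂ B] [Module ℂ X] [Module ℂ Y] {i : B →ₗ[ℂ] X} {p : X →ₗ[ℂ] A}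
      {s : A →ₗ[ℂ] X} (he : LinearMap.range i = LinearMap.ker p) (hs : p ∘ₗ s = LinearMap.id)
      (f : Y →ₗ[ℂ] A) (η : Y →ₗ[ℂ] B) : p ∘ₗ (s ∘ₗ f - i ∘ₗ η) = f := by
    rw [LinearMap.comp_sub, ← LinearMap.comp_assoc, hs, ← LinearMap.comp_assoc,
      LinearMap.range_le_ker_iff.1 he.le, LinearMap.id_comp, LinearMap.zero_comp, sub_zero]
  exact ⟨⟨s0 ∘ₗ f.g0 - i.g0 ∘ₗ η0, s1 ∘ₗ f.g1 - i.g1 ∘ₗ η1, s2 ∘ₗ f.gf - i.gf ∘ₗ η2,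
    key i.comm_a1 f.comm_a1 h1 k1, key i.comm_a2 f.comm_a2 h2 k2, key i.comm_b1 f.comm_b1 h3 k3,
    key i.comm_b2 f.comm_b2 h4 k4, key i.comm_w f.comm_w h5 k5⟩, key' e0 hs0 _ _, key' e1 hs1 _ _⟩

/-- A morphism from the subobject of an extension extends if it pushes the extension class forward
to zero. -/
theorem RealizesExt.exists_desc {ξ : ExtCochain T B} (h : RealizesExt i p ξ) {B' : QRep}
    {f : QHom B B'} (hf : IsECoboundary T B' (ExtCochain.push ξ f)) :
    ∃ g : QHom E B', g.g0 ∘ₗ i.g0 = f.g0 ∧ g.g1 ∘ₗ i.g1 = f.g1 := by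
  obtain ⟨⟨i0, i1, i2, -, -, -, e0, e1, e2⟩, s0, s1, s2, hs0, hs1, hs2, h1, h2, h3, h4, h5⟩ := h
  obtain ⟨η0, η1, η2, k1, k2, k3, k4, k5⟩ := hf
  have retr {B X A : Type} [AddCommGroup A] [AddCommGroup B] [AddCommGroup X]
      [Module ℂ A] [Module ℂ B] [Module ℂ X] {i : B →ₗ[ℂ] X} {p : X →ₗ[ℂ] A}
      {s : A →ₗ[ℂ] X} (hi : Function.Injective i) (he : LinearMap.range i = LinearMap.ker p)
      (hs : p ∘ₗ s = LinearMap.id) : ∃ r : X →ₗ[ℂ] B, i ∘ₗ r = LinearMap.id - s ∘ₗ p := by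
    refine exists_lift_of_range_le hi ?_
    rw [he, LinearMap.range_le_ker_iff, LinearMap.comp_sub, ← LinearMap.comp_assoc, hs,
      LinearMap.comp_id, LinearMap.id_comp, sub_self]
  obtain ⟨r0, hr0⟩ := retr i0 e0 hs0
  obtain ⟨r1, hr1⟩ := retr i1 e1 hs1
  obtain ⟨r2, hr2⟩ := retr i2 e2 hs2
  have key {A A' B B' X X' Y Y' : Type} [AddCommGroup A] [AddCommGroup A'] [AddCommGroup B]
      [AddCommGroup B'] [AddCommGroup X] [AddCommGroup X'] [AddCommGroup Y] [AddCommGroup Y']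
      [Module ℂ A] [Module ℂ A'] [Module ℂ B] [Module ℂ B'] [Module ℂ X] [Module ℂ X']
      [Module ℂ Y] [Module ℂ Y'] {α : A →ₗ[ℂ] A'} {β : B →ₗ[ℂ] B'} {γ : X →ₗ[ℂ] X'}
      {δ : Y →ₗ[ℂ] Y'} {i : B →ₗ[ℂ] X} {i' : B' →ₗ[ℂ] X'} {p : X →ₗ[ℂ] A} {p' : X' →ₗ[ℂ] A'}
      {f : B →ₗ[ℂ] Y} {f' : B' →ₗ[ℂ] Y'}
      {s : A →ₗ[ℂ] X} {s' : A' →ₗ[ℂ] X'} {r : X →ₗ[ℂ] B} {r' : X' →ₗ[ℂ] B'} {ξ : A →ₗ[ℂ] B'}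
      {η : A →ₗ[ℂ] Y} {η' : A' →ₗ[ℂ] Y'} (hi : Function.Injective i')
      (ci : i' ∘ₗ β = γ ∘ₗ i) (cp : p' ∘ₗ γ = α ∘ₗ p) (cf : f' ∘ₗ β = δ ∘ₗ f)
      (hr : i ∘ₗ r = LinearMap.id - s ∘ₗ p) (hr' : i' ∘ₗ r' = LinearMap.id - s' ∘ₗ p')
      (hξ : i' ∘ₗ ξ = γ ∘ₗ s - s' ∘ₗ α) (hη : f' ∘ₗ ξ = δ ∘ₗ η - η' ∘ₗ α) :
      (f' ∘ₗ r' + η' ∘ₗ p') ∘ₗ γ = δ ∘ₗ (f ∘ₗ r + η ∘ₗ p) := by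
    ext x
    have ci := LinearMap.congr_fun ci (r x)
    have cp := LinearMap.congr_fun cp x
    have cf := LinearMap.congr_fun cf (r x)
    have hξ := LinearMap.congr_fun hξ (p x)
    have hη := LinearMap.congr_fun hη (p x)
    have hr := LinearMap.congr_fun hr x
    have hr' := LinearMap.congr_fun hr' (γ x)
    simp only [LinearMap.comp_apply, LinearMap.sub_apply, LinearMap.add_apply, map_add,
      LinearMap.id_apply] at ci cp cf hξ hη hr hr' ⊢
    have : r' (γ x) = β (r x) + ξ (p x) := hi <| by
      rw [map_add, hr', ci, hr, hξ, cp, map_sub]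
      abel
    rw [this, map_add, cf, hη, cp]
    abel
  have key' {B X A Y : Type} [AddCommGroup A] [AddCommGroup B] [AddCommGroup X] [AddCommGroup Y]
      [Module ℂ A] [Module ℂ B] [Module ℂ X] [Module ℂ Y] {i : B →ₗ[ℂ] X} {p : X →ₗ[ℂ] A}
      {s : A →ₗ[ℂ] X} {r : X →ₗ[ℂ] B} (hi : Function.Injective i)
      (he : LinearMap.range i = LinearMap.ker p) (hr : i ∘ₗ r = LinearMap.id - s ∘ₗ p)
      (f : B →ₗ[ℂ] Y) (η : A →ₗ[ℂ] Y) : (f ∘ₗ r + η ∘ₗ p) ∘ₗ i = f := by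
    have h0 : p ∘ₗ i = 0 := LinearMap.range_le_ker_iff.1 he.le
    have h1 : r ∘ₗ i = LinearMap.id := by
      rw [← LinearMap.cancel_left hi, ← LinearMap.comp_assoc, hr, LinearMap.sub_comp,
        LinearMap.comp_assoc, h0, LinearMap.comp_zero, sub_zero]
      rfl
    rw [LinearMap.add_comp, LinearMap.comp_assoc, h1, LinearMap.comp_assoc, h0,
      LinearMap.comp_zero, add_zero, LinearMap.comp_id]
  exact ⟨⟨f.g0 ∘ₗ r0 + η0 ∘ₗ p.g0, f.g1 ∘ₗ r1 + η1 ∘ₗ p.g1, f.gf ∘ₗ r2 + η2 ∘ₗ p.gf,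
    key i1 i.comm_a1 p.comm_a1 f.comm_a1 hr0 hr1 h1 k1,
    key i1 i.comm_a2 p.comm_a2 f.comm_a2 hr0 hr1 h2 k2,
    key i0 i.comm_b1 p.comm_b1 f.comm_b1 hr1 hr0 h3 k3,
    key i0 i.comm_b2 p.comm_b2 f.comm_b2 hr1 hr0 h4 k4,
    key i0 i.comm_w p.comm_w f.comm_w hr2 hr0 h5 k5⟩, key' i0 e0 hr0 _ _, key' i1 e1 hr1 _ _⟩

end

/-! ### Powers of a module -/

section

variable {A B : Type} [AddCommGroup A] [AddCommGroup B] [Module ℂ A] [Module ℂ B] {k : ℕ}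

theorem pi_single_smul_id (j : Fin k) :
    (LinearMap.pi fun l => (Pi.single j 1 : Fin k → ℂ) l • LinearMap.id : A →ₗ[ℂ] Fin k → A) =
      LinearMap.single ℂ (fun _ => A) j := by
  ext x l
  rcases eq_or_ne l j with rfl | h
  · simp
  · simp [h]

theorem sum_single_smul_proj (j : Fin k) :
    (∑ l, (Pi.single j 1 : Fin k → ℂ) l • LinearMap.proj l : (Fin k → A) →ₗ[ℂ] A) =
      LinearMap.proj j := by
  rw [Finset.sum_eq_single j (fun l _ h => by rw [Pi.single_eq_of_ne h, zero_smul])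
    (fun h => (h (Finset.mem_univ j)).elim), Pi.single_eq_same, one_smul]

theorem sum_comp_single_comp_proj (f : (Fin k → A) →ₗ[ℂ] B) :
    ∑ j, (f ∘ₗ LinearMap.single ℂ (fun _ => A) j) ∘ₗ LinearMap.proj j = f := by
  refine LinearMap.ext fun x => ?_
  simp only [LinearMap.coe_sum, Finset.sum_apply, LinearMap.comp_apply, LinearMap.proj_apply,
    LinearMap.coe_single, ← map_sum, Finset.univ_sum_single]

theorem sum_smul_comp_single (f : (Fin k → A) →ₗ[ℂ] B) (c : Fin k → ℂ) :
    ∑ j, c j • (f ∘ₗ LinearMap.single ℂ (fun _ => A) j) =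
      f ∘ₗ (LinearMap.pi fun j => c j • LinearMap.id : A →ₗ[ℂ] Fin k → A) := by
  ext x
  simp only [LinearMap.coe_sum, Finset.sum_apply, LinearMap.smul_apply, LinearMap.comp_apply,
    ← map_smul, ← map_sum]
  congr 1
  ext l
  simp [Finset.sum_apply, Pi.single_apply]

theorem sum_smul_proj_comp (f : A →ₗ[ℂ] Fin k → B) (c : Fin k → ℂ) :
    ∑ j, c j • (LinearMap.proj j ∘ₗ f) =
      (∑ j, c j • LinearMap.proj j : (Fin k → B) →ₗ[ℂ] B) ∘ₗ f := by
  ext x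
  simp

end

namespace ExtCochain

variable {B C T : QRep} {k : ℕ}

theorem assembleRow_pull (ξ : ExtCochain (C.pow k) B) :
    assembleRow (fun j => pull ξ (QHom.diag C (Pi.single j 1))) = ξ := by
  simp only [assembleRow, pull, QHom.diag_g0, QHom.diag_g1, QHom.diag_gf, pi_single_smul_id]
  refine Prod.ext ?_ (Prod.ext ?_ (Prod.ext ?_ (Prod.ext ?_ ?_))) <;>
  exact sum_comp_single_comp_proj _

theorem sum_smul_pull (ξ : ExtCochain (C.pow k) B) (c : Fin k → ℂ) :
    ∑ j, c j • pull ξ (QHom.diag C (Pi.single j 1)) = pull ξ (QHom.diag C c) := by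
  simp only [pull, QHom.diag_g0, QHom.diag_g1, QHom.diag_gf, pi_single_smul_id]
  refine Prod.ext ?_ (Prod.ext ?_ (Prod.ext ?_ (Prod.ext ?_ ?_))) <;>
  simp only [Prod.fst_sum, Prod.snd_sum, Prod.smul_fst, Prod.smul_snd] <;>
  exact sum_smul_comp_single _ _

theorem assembleCol_push (ξ : ExtCochain T (C.pow k)) :
    assembleCol (fun j => push ξ (QHom.comb C (Pi.single j 1))) = ξ := by
  simp only [assembleCol, push, QHom.comb_g0, QHom.comb_g1, sum_single_smul_proj]
  rfl

theorem sum_smul_push (ξ : ExtCochain T (C.pow k)) (c : Fin k → ℂ) :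
    ∑ j, c j • push ξ (QHom.comb C (Pi.single j 1)) = push ξ (QHom.comb C c) := by
  simp only [push, QHom.comb_g0, QHom.comb_g1, sum_single_smul_proj]
  refine Prod.ext ?_ (Prod.ext ?_ (Prod.ext ?_ (Prod.ext ?_ ?_))) <;>
  simp only [Prod.fst_sum, Prod.snd_sum, Prod.smul_fst, Prod.smul_snd] <;>
  exact sum_smul_proj_comp _ _

end ExtCochain

theorem QRep.d0_pow (C : QRep) (k : ℕ) : (C.pow k).d0 = k * C.d0 := by
  change finrank ℂ (Fin k → C.V0) = _
  rw [finrank_pi_fintype, Finset.sum_const, Finset.card_univ, Fintype.card_fin, smul_eq_mul,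
    QRep.d0]

theorem QRep.d1_pow (C : QRep) (k : ℕ) : (C.pow k).d1 = k * C.d1 := by
  change finrank ℂ (Fin k → C.V1) = _
  rw [finrank_pi_fintype, Finset.sum_const, Finset.card_univ, Fintype.card_fin, smul_eq_mul,
    QRep.d1]

theorem QRep.wt_pow (C : QRep) (k : ℕ) (ζ : ℝ × ℝ) : (C.pow k).wt ζ = k * C.wt ζ := by
  simp only [QRep.wt, QRep.d0_pow, QRep.d1_pow]
  push_cast
  ring

theorem QRep.subsingleton_Vf_pow {C : QRep} (hC : finrank ℂ C.Vf = 0) (k : ℕ) :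
    Subsingleton (C.pow k).Vf :=
  have := finrank_zero_iff.1 hC
  inferInstanceAs (Subsingleton (Fin k → C.Vf))

theorem QRep.eq_of_dim_pow {C : QRep} (hC : 0 < C.d0 + C.d1) {k k' : ℕ}
    (h0 : (C.pow k).d0 = (C.pow k').d0) (h1 : (C.pow k).d1 = (C.pow k').d1) : k = k' := by
  rw [QRep.d0_pow, QRep.d0_pow] at h0
  rw [QRep.d1_pow, QRep.d1_pow] at h1
  exact Nat.eq_of_mul_eq_mul_right hC (by rw [mul_add, mul_add, h0, h1])

/-! ### Decompositions near a wall -/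

namespace QSub

variable {U V W : QRep}

theorem wt_map_of_injective {f : QHom V W} (h0 : Function.Injective f.g0)
    (h1 : Function.Injective f.g1) (ζ : ℝ × ℝ) (S : QSub V) : (S.map f).wt ζ = S.wt ζ := by
  have e0 : finrank ℂ (S.map f).S0 = finrank ℂ S.S0 := finrank_map_of_injective h0 _
  have e1 : finrank ℂ (S.map f).S1 = finrank ℂ S.S1 := finrank_map_of_injective h1 _
  rw [wt, e0, e1, wt]

theorem wt_sup_map_add_wt_comap (f : QHom U V) (ζ : ℝ × ℝ) (S : QSub V) :
    (S.sup ((top U).map f)).wt ζ + (S.comap f).wt ζ = S.wt ζ + U.wt ζ := by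
  have h0 := finrank_sup_range_add_finrank_comap f.g0 S.S0
  have h1 := finrank_sup_range_add_finrank_comap f.g1 S.S1
  rw [LinearMap.range_eq_map] at h0 h1
  change finrank ℂ (S.sup ((top U).map f)).S0 + finrank ℂ (S.comap f).S0 = _ at h0
  change finrank ℂ (S.sup ((top U).map f)).S1 + finrank ℂ (S.comap f).S1 = _ at h1
  rify at h0 h1
  simp only [wt, QRep.wt, QRep.d0, QRep.d1]
  linear_combination ζ.1 * h0 + ζ.2 * h1

end QSub

section

variable {ζ : ℝ × ℝ} {V E K : QRep}

theorem IsStableFr.isTop_comap (hVf : finrank ℂ V.Vf = 1) (hV : IsStableFr ζ V) (i : QHom V E)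
    (hle : ∀ S : QSub E, S.Sf = ⊤ → S.wt ζ ≤ E.wt ζ) {S : QSub E}
    (hSf : S.Sf = ⊤) (hS : S.wt ζ = E.wt ζ) : (S.comap i).IsTop := by
  by_contra h
  have h1 := ((isStableFr_iff hVf).1 hV).2 _ (QSub.Sf_comap_of_eq_top hSf) h
  have h2 := hle (S.sup ((QSub.top V).map i)) (by rw [QSub.sup_Sf, hSf, top_sup_eq])
  have h3 := QSub.wt_sup_map_add_wt_comap i ζ S
  linarith

theorem IsStableFr.isBot_map_comp (hVf : finrank ℂ V.Vf = 1) (hV : IsStableFr ζ V) (p : QHom E V)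
    (hle : ∀ S : QSub E, S.Sf = ⊥ → S.wt ζ ≤ 0) {i : QHom K E} (h0 : Function.Injective i.g0)
    (h1 : Function.Injective i.g1) (hKf : Subsingleton K.Vf) (hK : K.wt ζ = 0) :
    ((QSub.top K).map (p.comp i)).IsBot := by
  by_contra h
  have h1' := ((isStableFr_iff hVf).1 hV).1 _
    (QSub.Sf_map_of_eq_bot (Subsingleton.elim _ _)) h
  have h2 := hle (((QSub.bot V).comap (p.comp i)).map i)
    (QSub.Sf_map_of_eq_bot (Subsingleton.elim _ _))
  have h3 := QSub.wt_ker_add_wt_range ζ (p.comp i)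
  rw [QSub.wt_map_of_injective h0 h1] at h2
  linarith

end

section

variable {ζ : ℝ × ℝ} {E V V' K K' : QRep}

/-- Uniqueness of the stable submodule in an extension by unframed modules of weight zero. -/
theorem IsExactSeq.qIso_left {i : QHom V E} {p : QHom E K} {i' : QHom V' E} {p' : QHom E K'}
    (h : IsExactSeq i p) (h' : IsExactSeq i' p') (hVf : finrank ℂ V.Vf = 1)
    (hV : IsStableFr ζ V) (hVf' : finrank ℂ V'.Vf = 1) (hV' : IsStableFr ζ V')
    (hle : ∀ S : QSub E, S.Sf = ⊤ → S.wt ζ ≤ E.wt ζ) (hK : K.wt ζ = 0)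
    (hK' : K'.wt ζ = 0) (hKf : Subsingleton K.Vf) (hKf' : Subsingleton K'.Vf) : QIso V V' := by
  have e : V.wt ζ = E.wt ζ := by rw [← h.wt_eq ζ, hK, add_zero]
  have e' : V'.wt ζ = E.wt ζ := by rw [← h'.wt_eq ζ, hK', add_zero]
  obtain ⟨i0, i1, i2, -, -, -, -, -, r2⟩ := h
  obtain ⟨i0', i1', i2', -, -, -, -, -, r2'⟩ := h'
  have t : LinearMap.range i.gf = ⊤ := r2.trans (by rw [Subsingleton.elim p.gf 0, LinearMap.ker_zero])
  have t' : LinearMap.range i'.gf = ⊤ :=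
    r2'.trans (by rw [Subsingleton.elim p'.gf 0, LinearMap.ker_zero])
  have key {A B X : Type} [AddCommGroup A] [AddCommGroup B] [AddCommGroup X] [Module ℂ A]
      [Module ℂ B] [Module ℂ X] {f : A →ₗ[ℂ] X} {f' : B →ₗ[ℂ] X}
      (hf : ((⊤ : Submodule ℂ B).map f').comap f = ⊤) : LinearMap.range f ≤ LinearMap.range f' := by
    rw [LinearMap.range_eq_map, LinearMap.range_eq_map]
    exact Submodule.map_le_iff_le_comap.2 hf.ge
  have a := hV.isTop_comap hVf i hle (QSub.Sf_map_of_eq_top (T := QSub.top V') t' rfl)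
    (by rw [QSub.wt_map_of_injective i0' i1', QSub.wt_top, e'])
  have a' := hV'.isTop_comap hVf' i' hle (QSub.Sf_map_of_eq_top (T := QSub.top V) t rfl)
    (by rw [QSub.wt_map_of_injective i0 i1, QSub.wt_top, e])
  obtain ⟨f, f0, f1, f2⟩ := QHom.exists_lift i0' i1' i2' (key a.1) (key a.2.1) (key a.2.2)
  obtain ⟨g, g0, g1, g2⟩ := QHom.exists_lift i0 i1 i2 (key a'.1) (key a'.2.1) (key a'.2.2)
  have inj {A B X : Type} [AddCommGroup A] [AddCommGroup B] [AddCommGroup X] [Module ℂ A]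
      [Module ℂ B] [Module ℂ X] {f : A →ₗ[ℂ] B} {i' : B →ₗ[ℂ] X} {i : A →ₗ[ℂ] X}
      (hi : Function.Injective i) (hf : i' ∘ₗ f = i) : Function.Injective f := by
    rw [← hf, LinearMap.coe_comp] at hi
    exact hi.of_comp
  exact QIso.of_injective (inj i0 f0) (inj i1 f1) (inj i2 f2) (inj i0' g0) (inj i1' g1)
    (inj i2' g2)

/-- Uniqueness of the stable quotient in an extension by unframed modules of weight zero. -/
theorem IsExactSeq.qIso_right {i : QHom K E} {p : QHom E V} {i' : QHom K' E} {p' : QHom E V'}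
    (h : IsExactSeq i p) (h' : IsExactSeq i' p') (hVf : finrank ℂ V.Vf = 1)
    (hV : IsStableFr ζ V) (hVf' : finrank ℂ V'.Vf = 1) (hV' : IsStableFr ζ V')
    (hle : ∀ S : QSub E, S.Sf = ⊥ → S.wt ζ ≤ 0) (hK : K.wt ζ = 0)
    (hK' : K'.wt ζ = 0) (hKf : Subsingleton K.Vf) (hKf' : Subsingleton K'.Vf) : QIso V V' := by
  obtain ⟨i0, i1, -, p0, p1, p2, r0, r1, r2⟩ := h
  obtain ⟨i0', i1', -, p0', p1', p2', r0', r1', r2'⟩ := h'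
  have a := hV.isBot_map_comp hVf p hle i0' i1' hKf' hK'
  have a' := hV'.isBot_map_comp hVf' p' hle i0 i1 hKf hK
  have key {A B X : Type} [AddCommGroup A] [AddCommGroup B] [AddCommGroup X] [Module ℂ A]
      [Module ℂ B] [Module ℂ X] {i : A →ₗ[ℂ] X} {p' : X →ₗ[ℂ] B} {S : Submodule ℂ X}
      (hr : LinearMap.range i = S) (h : (⊤ : Submodule ℂ A).map (p' ∘ₗ i) = ⊥) :
      S ≤ LinearMap.ker p' := by
    rw [← hr, LinearMap.range_le_ker_iff, ← LinearMap.range_eq_bot, LinearMap.range_eq_map, h]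
  obtain ⟨f, f0, f1, f2⟩ := QHom.exists_desc p0 p1 p2 (key r0 a'.1) (key r1 a'.2.1)
    (key r2 a'.2.2)
  obtain ⟨g, g0, g1, g2⟩ := QHom.exists_desc p0' p1' p2' (key r0' a.1) (key r1' a.2.1)
    (key r2' a.2.2)
  have surj {A B X : Type} [AddCommGroup A] [AddCommGroup B] [AddCommGroup X] [Module ℂ A]
      [Module ℂ B] [Module ℂ X] {p : X →ₗ[ℂ] A} {q : X →ₗ[ℂ] B} {f : A →ₗ[ℂ] B}
      (hq : Function.Surjective q) (hf : f ∘ₗ p = q) : Function.Surjective f := by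
    rw [← hf, LinearMap.coe_comp] at hq
    exact hq.of_comp
  exact QIso.of_surjective (surj p0' f0) (surj p1' f1) (surj p2' f2) (surj p0 g0) (surj p1 g1)
    (surj p2 g2)

end

section

variable {ζ : ℝ × ℝ} {E C : QRep}

/-- A framed module stable in the positive chamber has no unframed submodule of positive weight. -/
theorem IsStableFr.wt_nonpos_of_injective (hE : finrank ℂ E.Vf = 1) (hst : IsStableFr ζ E)
    (hC : finrank ℂ C.Vf = 0) {g : QHom C E} (h0 : Function.Injective g.g0)
    (h1 : Function.Injective g.g1) : C.wt ζ ≤ 0 := by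
  have := finrank_zero_iff.1 hC
  rw [← QSub.wt_top, ← QSub.wt_map_of_injective h0 h1]
  by_cases hb : ((QSub.top C).map g).IsBot
  · exact (hb.wt_eq ζ).le
  · exact (((isStableFr_iff hE).1 hst).1 _ (QSub.Sf_map_of_eq_bot (Subsingleton.elim _ _)) hb).le

theorem IsStableFr.wt_nonneg_of_surjective (hE : finrank ℂ E.Vf = 1) (hst : IsStableFr ζ E)
    (hC : finrank ℂ C.Vf = 0) {g : QHom E C} (h0 : Function.Surjective g.g0)
    (h1 : Function.Surjective g.g1) : 0 ≤ C.wt ζ := by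
  have := finrank_zero_iff.1 hC
  have e := QSub.wt_ker_add_wt_range ζ g
  have e' : ((QSub.top E).map g).wt ζ = C.wt ζ := QSub.IsTop.wt_eq (S := (QSub.top E).map g)
    ⟨(Submodule.map_top _).trans (LinearMap.range_eq_top.2 h0),
      (Submodule.map_top _).trans (LinearMap.range_eq_top.2 h1), Subsingleton.elim _ _⟩ ζ
  by_cases hb : ((QSub.bot C).comap g).IsTop
  · have := hb.wt_eq ζ
    linarith
  · have := ((isStableFr_iff hE).1 hst).2 ((QSub.bot C).comap g)
      (QSub.Sf_comap_of_eq_top (Subsingleton.elim _ _)) hb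
    linarith

theorem QHom.diag_injective {k : ℕ} {c : Fin k → ℂ} (hc : c ≠ 0) :
    Function.Injective (QHom.diag C c).g0 ∧ Function.Injective (QHom.diag C c).g1 := by
  obtain ⟨j, hj⟩ := Function.ne_iff.1 hc
  exact ⟨fun x y h => smul_right_injective _ hj (congrFun h j),
    fun x y h => smul_right_injective _ hj (congrFun h j)⟩

theorem QHom.comb_surjective {k : ℕ} {c : Fin k → ℂ} (hc : c ≠ 0) :
    Function.Surjective (QHom.comb C c).g0 ∧ Function.Surjective (QHom.comb C c).g1 := by
  obtain ⟨j, hj⟩ := Function.ne_iff.1 hc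
  have key {A : Type} [AddCommGroup A] [Module ℂ A] :
      Function.Surjective (∑ j, c j • LinearMap.proj j : (Fin k → A) →ₗ[ℂ] A) := by
    intro x
    refine ⟨Pi.single j ((c j)⁻¹ • x), ?_⟩
    simp only [LinearMap.coe_sum, Finset.sum_apply, LinearMap.smul_apply, LinearMap.proj_apply]
    rw [Finset.sum_eq_single j (fun l _ h => by rw [Pi.single_eq_of_ne h, smul_zero])
      (fun h => (h (Finset.mem_univ j)).elim), Pi.single_eq_same, smul_inv_smul₀ hj]
  exact ⟨key, key⟩

theorem RealizesExt.eq_zero_of_pull {V : QRep} {k : ℕ} {i : QHom V E} {p : QHom E (C.pow k)}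
    {ξ : ExtCochain (C.pow k) V} (h : RealizesExt i p ξ) (hE : finrank ℂ E.Vf = 1)
    (hst : IsStableFr ζ E) (hC : finrank ℂ C.Vf = 0) (hpos : 0 < C.wt ζ) {c : Fin k → ℂ}
    (hc : IsECoboundary C V (∑ j, c j • ExtCochain.pull ξ (QHom.diag C (Pi.single j 1)))) :
    c = 0 := by
  by_contra hne
  rw [ExtCochain.sum_smul_pull] at hc
  obtain ⟨g, e0, e1⟩ := h.exists_lift hc
  obtain ⟨d0, d1⟩ := QHom.diag_injective (C := C) hne
  rw [← e0, LinearMap.coe_comp] at d0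
  rw [← e1, LinearMap.coe_comp] at d1
  exact hpos.not_ge (hst.wt_nonpos_of_injective hE hC d0.of_comp d1.of_comp)

theorem RealizesExt.eq_zero_of_push {V : QRep} {k : ℕ} {i : QHom (C.pow k) E} {p : QHom E V}
    {ξ : ExtCochain V (C.pow k)} (h : RealizesExt i p ξ) (hE : finrank ℂ E.Vf = 1)
    (hst : IsStableFr ζ E) (hC : finrank ℂ C.Vf = 0) (hneg : C.wt ζ < 0) {c : Fin k → ℂ}
    (hc : IsECoboundary V C (∑ j, c j • ExtCochain.push ξ (QHom.comb C (Pi.single j 1)))) :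
    c = 0 := by
  by_contra hne
  rw [ExtCochain.sum_smul_push] at hc
  obtain ⟨g, e0, e1⟩ := h.exists_desc hc
  obtain ⟨d0, d1⟩ := QHom.comb_surjective (C := C) hne
  rw [← e0, LinearMap.coe_comp] at d0
  rw [← e1, LinearMap.coe_comp] at d1
  exact hneg.not_ge (hst.wt_nonneg_of_surjective hE hC d0.of_comp d1.of_comp)

end

/-- **Nagao–Nakajima, Proposition 3.5.**
Let `ζ°` lie on a wall `L`, `C` the unique `θ_{ζ°}`-stable `A`-module
with `ζ°·dim C = 0`, and `ζ^± = ζ° ± (ε,ε)` for sufficiently small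
`ε > 0` (the adjacent chambers).

(1) Every `ζ^+`-stable framed module `Ṽ'` fits into a short exact
sequence `0 → Ṽ → Ṽ' → C^{⊕k} → 0` of `Ã`-modules in which `Ṽ` is
`ζ°`-stable; the integer `k` and the isomorphism class of `Ṽ` are
uniquely determined; and the composition
`ℂ^k ≅ Hom_Ã(C, C^{⊕k}) → Ext¹_Ã(C, Ṽ)` induced by the extension class
of `Ṽ'` is injective (equivalently: expressing `Ṽ'` by cocycles
`ξ 0, …, ξ (k−1)`, no nontrivial linear combination `∑ c j • ξ j`
is a coboundary).

(2) Dually, every `ζ^-`-stable framed module `Ṽ''` fits into a short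
exact sequence `0 → C^{⊕k} → Ṽ'' → Ṽ → 0` with `Ṽ` `ζ°`-stable, `k` and
the isomorphism class of `Ṽ` uniquely determined, and the induced map
`ℂ^k → Ext¹_Ã(Ṽ, C)` injective. -/
theorem stable_module_near_wall_decomposition
    (ζ : ℝ × ℝ) (m : ℕ) (hwall : OnWall ζ m)
    (C : QRep) (hCf : Module.finrank ℂ C.Vf = 0) (hCne : 0 < C.d0 + C.d1)
    (hCst : IsStableUn ζ C)
    (hCslope : ζ.1 * (C.d0 : ℝ) + ζ.2 * (C.d1 : ℝ) = 0)
    (hCuniq : ∀ C' : QRep, Module.finrank ℂ C'.Vf = 0 → 0 < C'.d0 + C'.d1 →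
      IsStableUn ζ C' → ζ.1 * (C'.d0 : ℝ) + ζ.2 * (C'.d1 : ℝ) = 0 → QIso C' C) :
    ∃ ε₀ > (0 : ℝ), ∀ ε : ℝ, 0 < ε → ε < ε₀ →
      -- (1) decomposition of `ζ⁺`-stable framed modules
      (∀ E : QRep, Module.finrank ℂ E.Vf = 1 →
        IsStableFr (ζ.1 + ε, ζ.2 + ε) E →
        ∃ (k : ℕ) (V : QRep), Module.finrank ℂ V.Vf = 1 ∧ IsStableFr ζ V ∧
          ∃ (ξ : Fin k → ExtCochain C V) (i : QHom V E) (p : QHom E (C.pow k)),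
            (∀ j, IsECocycle C V (ξ j)) ∧
            RealizesExt i p (assembleRow ξ) ∧
            (∀ c : Fin k → ℂ, IsECoboundary C V (∑ j, c j • ξ j) → c = 0) ∧
            (∀ (k' : ℕ) (V' : QRep), Module.finrank ℂ V'.Vf = 1 →
              IsStableFr ζ V' →
              ∀ (ξ' : Fin k' → ExtCochain C V') (i' : QHom V' E)
                (p' : QHom E (C.pow k')),
                (∀ j, IsECocycle C V' (ξ' j)) →
                RealizesExt i' p' (assembleRow ξ') →
                k = k' ∧ QIso V V')) ∧
      -- (2) decomposition of `ζ⁻`-stable framed modules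
      (∀ E : QRep, Module.finrank ℂ E.Vf = 1 →
        IsStableFr (ζ.1 - ε, ζ.2 - ε) E →
        ∃ (k : ℕ) (V : QRep), Module.finrank ℂ V.Vf = 1 ∧ IsStableFr ζ V ∧
          ∃ (ξ : Fin k → ExtCochain V C) (i : QHom (C.pow k) E) (p : QHom E V),
            (∀ j, IsECocycle V C (ξ j)) ∧
            RealizesExt i p (assembleCol ξ) ∧
            (∀ c : Fin k → ℂ, IsECoboundary V C (∑ j, c j • ξ j) → c = 0) ∧
            (∀ (k' : ℕ) (V' : QRep), Module.finrank ℂ V'.Vf = 1 →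
              IsStableFr ζ V' →
              ∀ (ξ' : Fin k' → ExtCochain V' C) (i' : QHom (C.pow k') E)
                (p' : QHom E V'),
                (∀ j, IsECocycle V' C (ξ' j)) →
                RealizesExt i' p' (assembleCol ξ') →
                k = k' ∧ QIso V V')) := by

  have hCwt : C.wt ζ = 0 := hCslope
  have hC : IsStableZero ζ C := by
    simpa only [hCwt, zero_div, neg_zero, add_zero] using hCst.isStableZero hCf hCne
  obtain ⟨ε₀, hε₀, hgap₀⟩ := hwall.exists_gap
  refine ⟨ε₀, hε₀, fun ε hε hlt => ?_⟩
  have hdim : 0 < ((C.d0 + C.d1 : ℕ) : ℝ) := Nat.cast_pos.2 hCne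
  have hgap : HasGap ζ ε := fun V hf hd hst hne =>
    (mul_lt_mul_of_pos_right hlt (Nat.cast_pos.2 hd)).trans_le (hgap₀ V hf hd hst hne)
  have hpow (k : ℕ) : (C.pow k).wt ζ = 0 := by rw [QRep.wt_pow, hCwt, mul_zero]
  have hpowf := QRep.subsingleton_Vf_pow hCf
  refine ⟨fun E hE hst => ?_, fun E hE hst => ?_⟩
  · obtain ⟨S, hSf, hS, hQ⟩ := hst.exists_sub_of_add hε hE hgap
    obtain ⟨k, hk⟩ := hQ.exists_qIso_pow hC hwall.exists_int.1 hwall.add_ne_zero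
    obtain ⟨p, hex⟩ := S.isExactSeq.exists_of_qIso_right hk.symm
    obtain ⟨ξ, hξ⟩ := hex.exists_realizesExt
    have hpos : 0 < C.wt (ζ.1 + ε, ζ.2 + ε) := by
      rw [QRep.wt_add_smul, hCwt, zero_add]
      exact mul_pos hε hdim
    refine ⟨k, S.toRep, hSf, hS, fun j => ExtCochain.pull ξ (QHom.diag C (Pi.single j 1)),
      S.incl, p, fun j => hξ.isECocycle.pull _, by rwa [ExtCochain.assembleRow_pull],
      fun c hc => hξ.eq_zero_of_pull hE hst hCf hpos hc, ?_⟩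
    intro k' V' hVf' hV' ξ' i' p' _ hξ'
    have hiso := hex.qIso_left hξ'.1 hSf hS hVf' hV'
      (fun T hT => hst.wt_le_of_add hE hgap hT) (hpow k) (hpow k') (hpowf k) (hpowf k')
    refine ⟨?_, hiso⟩
    have h := hex.dim_eq
    have h' := hξ'.1.dim_eq
    have e := hiso.dim_eq
    exact QRep.eq_of_dim_pow hCne (by omega) (by omega)
  · obtain ⟨S, hSf, hS, hQ⟩ := hst.exists_sub_of_sub hε hE hgap
    obtain ⟨k, hk⟩ := hQ.exists_qIso_pow hC hwall.exists_int.1 hwall.add_ne_zero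
    obtain ⟨i, hex⟩ := S.isExactSeq.exists_of_qIso_left hk
    obtain ⟨ξ, hξ⟩ := hex.exists_realizesExt
    have hneg : C.wt (ζ.1 - ε, ζ.2 - ε) < 0 := by
      rw [sub_eq_add_neg, sub_eq_add_neg, QRep.wt_add_smul, hCwt, zero_add, neg_mul]
      exact neg_neg_of_pos (mul_pos hε hdim)
    refine ⟨k, S.quot, hSf, hS, fun j => ExtCochain.push ξ (QHom.comb C (Pi.single j 1)),
      i, S.proj, fun j => hξ.isECocycle.push _, by rwa [ExtCochain.assembleCol_push],
      fun c hc => hξ.eq_zero_of_push hE hst hCf hneg hc, ?_⟩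
    intro k' V' hVf' hV' ξ' i' p' _ hξ'
    have hiso := hex.qIso_right hξ'.1 hSf hS hVf' hV'
      (fun T hT => hst.wt_nonpos_of_sub hE hgap hT) (hpow k) (hpow k') (hpowf k) (hpowf k')
    refine ⟨?_, hiso⟩
    have h := hex.dim_eq
    have h' := hξ'.1.dim_eq
    have e := hiso.dim_eq
    exact QRep.eq_of_dim_pow hCne (by omega) (by omega)
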